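/- arXiv:math/0210079 — 2 statements merged into one kernel-verified Lean document; each statement's English description precedes it below -/
import Mathlib

section
/- Let I be a homogeneous ideal of S = k[x_1,…,x_n] and let in(I) be the initial ideal of I with respect to the reverse lexicographic order. Assume x_n, x_{n−1},…,x_1 is a filter-regular sequence in S/I. Then for every t with 0 ≤ t ≤ n: (i) reg_t(I) = reg_t(in(I)); (ii) a*_t(I) = a*_t(in(I)). -/
set_option synthInstance.maxHeartbeats 1000000
set_option maxHeartbeats 1000000

/-! Common definitions: gradings, term orders, initial ideals, generic initial ideals,
Borel-fixed ideals, filter-regular sequences, a Koszul/Čech-type description of graded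
local cohomology and the invariants `a_i`, `reg_t`, `a*_t`, minimal graded free
resolutions, and reductions. -/

namespace Paper

open MvPolynomial

noncomputable section

variable {k : Type*} [Field k] {n : ℕ}

/-- Total degree of an exponent vector. -/
def adeg (a : Fin n →₀ ℕ) : ℕ := ∑ j, a j

/-- `m(x^A)` : the largest (1-based) index `i` such that `xᵢ` divides `x^A`. -/
def mval (a : Fin n →₀ ℕ) : ℕ := a.support.sup fun j => (j : ℕ) + 1

/-- The degree-`d` homogeneous piece of the polynomial ring (`⊥` in negative degrees). -/
def sPiece (k : Type*) [Field k] (n : ℕ) (d : ℤ) : Submodule k (MvPolynomial (Fin n) k) :=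
  if 0 ≤ d then homogeneousSubmodule (Fin n) k d.toNat else ⊥

/-- `I` is a homogeneous (graded) ideal. -/
def IsHomog (I : Ideal (MvPolynomial (Fin n) k)) : Prop :=
  ∀ f ∈ I, ∀ d : ℕ, homogeneousComponent d f ∈ I

/-- Degree reverse lexicographic order with `x₁ > x₂ > ⋯ > xₙ` : `a < b`. -/
def drlt (a b : Fin n →₀ ℕ) : Prop :=
  adeg a < adeg b ∨
    (adeg a = adeg b ∧ ∃ i : Fin n, b i < a i ∧ ∀ j : Fin n, i < j → a j = b j)

/-- Lexicographic order with `x₁ > x₂ > ⋯ > xₙ` : `a < b`. -/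
def lexlt (a b : Fin n →₀ ℕ) : Prop :=
  ∃ i : Fin n, a i < b i ∧ ∀ j : Fin n, j < i → a j = b j

/-- An abstract term order on monomials in `n` variables. -/
structure TermOrder (n : ℕ) where
  lt : (Fin n →₀ ℕ) → (Fin n →₀ ℕ) → Prop
  irrefl : ∀ a, ¬ lt a a
  trans : ∀ a b c, lt a b → lt b c → lt a c
  total : ∀ a b, a ≠ b → lt a b ∨ lt b a
  add_right : ∀ a b c, lt a b → lt (a + c) (b + c)
  zero_bot : ∀ a, a ≠ 0 → lt 0 a

/-- `a` is the leading exponent of `f` with respect to the term order `lt`. -/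
def IsLeadExp (lt : (Fin n →₀ ℕ) → (Fin n →₀ ℕ) → Prop)
    (f : MvPolynomial (Fin n) k) (a : Fin n →₀ ℕ) : Prop :=
  a ∈ f.support ∧ ∀ b ∈ f.support, b ≠ a → lt b a

/-- The initial ideal of `I` with respect to the term order `lt`. -/
def inIdealW (lt : (Fin n →₀ ℕ) → (Fin n →₀ ℕ) → Prop)
    (I : Ideal (MvPolynomial (Fin n) k)) : Ideal (MvPolynomial (Fin n) k) :=
  Ideal.span {m | ∃ f a, f ∈ I ∧ IsLeadExp lt f a ∧ m = monomial a (1 : k)}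

/-- The initial ideal with respect to the (degree) reverse lexicographic order. -/
def inIdeal (I : Ideal (MvPolynomial (Fin n) k)) : Ideal (MvPolynomial (Fin n) k) :=
  inIdealW drlt I

/-- The linear change of coordinates associated to a matrix `g`, `xⱼ ↦ ∑ᵢ gᵢⱼ xᵢ`. -/
def act (g : Matrix (Fin n) (Fin n) k) :
    MvPolynomial (Fin n) k →ₐ[k] MvPolynomial (Fin n) k :=
  aeval fun j => ∑ i, C (g i j) * X i

/-- The image of the ideal `I` under the linear change of coordinates `g`. -/
def actI (g : Matrix (Fin n) (Fin n) k) (I : Ideal (MvPolynomial (Fin n) k)) :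
    Ideal (MvPolynomial (Fin n) k) :=
  Ideal.map (act g) I

/-- `J` is the generic initial ideal of `I` w.r.t. the term order `lt`:
there is a nonempty Zariski-open subset `U ⊆ GL(n,k)` with `in(g I) = J` for all `g ∈ U`. -/
def IsGinW (lt : (Fin n →₀ ℕ) → (Fin n →₀ ℕ) → Prop)
    (I J : Ideal (MvPolynomial (Fin n) k)) : Prop :=
  ∃ U : Set (Matrix (Fin n) (Fin n) k), U.Nonempty ∧
    (∃ P : Set (MvPolynomial (Fin n × Fin n) k),
      U = {g | IsUnit g.det ∧ ∃ p ∈ P, MvPolynomial.eval (fun q => g q.1 q.2) p ≠ 0}) ∧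
    ∀ g ∈ U, inIdealW lt (actI g I) = J

/-- Generic initial ideal with respect to the reverse lexicographic order. -/
def IsGin (I J : Ideal (MvPolynomial (Fin n) k)) : Prop := IsGinW drlt I J

/-- `I` is a monomial ideal. -/
def IsMonomialIdeal (I : Ideal (MvPolynomial (Fin n) k)) : Prop :=
  ∃ A : Set (Fin n →₀ ℕ), I = Ideal.span ((fun a => (monomial a (1 : k))) '' A)

/-- The maximal graded ideal `𝔐 = (x₁, …, xₙ)` of the polynomial ring. -/
def maxIdeal (k : Type*) [Field k] (n : ℕ) : Ideal (MvPolynomial (Fin n) k) :=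
  Ideal.span (Set.range X)

/-- `x^a` is a minimal (monomial) generator of the monomial ideal `I`. -/
def IsMinGen (I : Ideal (MvPolynomial (Fin n) k)) (a : Fin n →₀ ℕ) : Prop :=
  monomial a (1 : k) ∈ I ∧ monomial a (1 : k) ∉ maxIdeal k n * I

def IsUpperTriangular (g : Matrix (Fin n) (Fin n) k) : Prop :=
  ∀ i j : Fin n, j < i → g i j = 0

/-- `I` is Borel-fixed: fixed by every invertible upper triangular change of coordinates. -/
def IsBorelFixed (I : Ideal (MvPolynomial (Fin n) k)) : Prop :=
  ∀ g : Matrix (Fin n) (Fin n) k, IsUnit g.det → IsUpperTriangular g → actI g I = I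

/-- Degree-`d` piece of the standard grading on `S/I` (for `I` homogeneous). -/
def qPiece (I : Ideal (MvPolynomial (Fin n) k)) (d : ℤ) :
    Submodule k (MvPolynomial (Fin n) k ⧸ I) :=
  (sPiece k n d).map (Ideal.Quotient.mkₐ k I).toLinearMap

/-- Degree-`d` piece of the standard grading on the ideal `I` viewed as a module. -/
def iPiece (I : Ideal (MvPolynomial (Fin n) k)) (d : ℤ) : Submodule k ↥I :=
  (sPiece k n d).comap ((I.subtype).restrictScalars k)

/-- The maximal graded ideal of `S/I`. -/
def maxIdealQ (I : Ideal (MvPolynomial (Fin n) k)) : Ideal (MvPolynomial (Fin n) k ⧸ I) :=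
  (maxIdeal k n).map (Ideal.Quotient.mk I)

/-- `z 0, …, z (s-1)` is a filter-regular sequence in `R` (with maximal graded ideal `mR`):
`z i` avoids all associated primes `≠ mR` of `(z 0, …, z (i-1))`. -/
def FilterRegular {R : Type*} [CommRing R] (mR : Ideal R) (z : ℕ → R) (s : ℕ) : Prop :=
  ∀ i < s, ∀ p ∈ associatedPrimes R (R ⧸ Ideal.span {x | ∃ j < i, x = z j}),
    p ≠ mR → z i ∉ p

/-- The sequence `xₙ, xₙ₋₁, …, x₁` in `S/I` (extended by `0`). -/
def revVars (I : Ideal (MvPolynomial (Fin n) k)) (j : ℕ) :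
    MvPolynomial (Fin n) k ⧸ I :=
  if h : j < n then Ideal.Quotient.mk I (X ⟨n - 1 - j, by omega⟩) else 0

section LC

variable {M : Type*} [AddCommGroup M]

/-- `i`-cochains of the stable Koszul (Čech) complex on the variables. -/
abbrev Koch (n : ℕ) (M : Type*) (i : ℕ) : Type _ :=
  {T : Finset (Fin n) // T.card = i} → M

/-- The differential (into cohomological degree `i`) of the Koszul complex
on `x₁ᵗ, …, xₙᵗ` with coefficients in `M`. -/
def kdelta [Module (MvPolynomial (Fin n) k) M] (t i : ℕ)
    (v : Koch n M (i - 1)) : Koch n M i := fun T =>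
  ∑ j ∈ T.1.attach,
    ((-1 : ℤ) ^ ((T.1.filter (fun l => l < j.1)).card)) •
      ((X j.1 ^ t : MvPolynomial (Fin n) k) •
        v ⟨T.1.erase j.1, by rw [Finset.card_erase_of_mem j.2, T.2]⟩)

/-- The transition map from the Koszul complex at level `t` to the one at level `t+1`. -/
def ktrans [Module (MvPolynomial (Fin n) k) M] (i : ℕ) (v : Koch n M i) : Koch n M i :=
  fun T => ((∏ j ∈ T.1, X j : MvPolynomial (Fin n) k)) • v T

/-- The cochain `v` lies in the degree-`d` strand (for the grading `ℳ` of `M`,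
where the Koszul generators at level `t` have degree `t`). -/
def strand [Module k M] (ℳ : ℤ → Submodule k M) (t i : ℕ) (d : ℤ)
    (v : Koch n M i) : Prop :=
  ∀ T, v T ∈ ℳ (d + (t : ℤ) * (i : ℤ))

/-- `H^i_𝔐(M)_d ≠ 0` : the degree-`d` strand of `i`-th local cohomology (computed as the
direct limit over `t` of the Koszul cohomology on `x₁ᵗ, …, xₙᵗ`) is nonzero. -/
def lcNonvanish (n : ℕ) [Module k M] [Module (MvPolynomial (Fin n) k) M]
    (ℳ : ℤ → Submodule k M) (i : ℕ) (d : ℤ) : Prop :=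
  ∃ (t : ℕ) (v : Koch n M i),
    strand ℳ t i d v ∧ kdelta (k := k) t (i + 1) v = 0 ∧
    ∀ s : ℕ, ¬ ∃ w : Koch n M (i - 1),
      strand ℳ (t + s) (i - 1) d w ∧
        kdelta (k := k) (t + s) i w = (ktrans (k := k) i)^[s] v

open Classical in
/-- `a_i(M)` : the largest degree `d` with `H^i_𝔐(M)_d ≠ 0` (`⊥` if `H^i_𝔐(M) = 0`). -/
def aDeg (n : ℕ) [Module k M] [Module (MvPolynomial (Fin n) k) M]
    (ℳ : ℤ → Submodule k M) (i : ℕ) : WithBot ℤ :=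
  if (∃ d : ℤ, lcNonvanish n ℳ i d) then
    ((sSup {d : ℤ | lcNonvanish n ℳ i d} : ℤ) : WithBot ℤ)
  else ⊥

/-- `reg_t(M) = max{a_i(M) + i : i ≤ t}`. -/
def regT (n : ℕ) [Module k M] [Module (MvPolynomial (Fin n) k) M]
    (ℳ : ℤ → Submodule k M) (t : ℕ) : WithBot ℤ :=
  (Finset.range (t + 1)).sup fun i => aDeg n ℳ i + ((i : ℤ) : WithBot ℤ)

/-- `a*_t(M) = max{a_i(M) : i ≤ t}`. -/
def aStarT (n : ℕ) [Module k M] [Module (MvPolynomial (Fin n) k) M]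
    (ℳ : ℤ → Submodule k M) (t : ℕ) : WithBot ℤ :=
  (Finset.range (t + 1)).sup fun i => aDeg n ℳ i

end LC

open Classical in
/-- Supremum of a set of integers, as an element of `WithBot ℤ` (`⊥` for the empty set). -/
def zSupBot (A : Set ℤ) : WithBot ℤ :=
  if A.Nonempty then ((sSup A : ℤ) : WithBot ℤ) else ⊥

section Res

variable (k) (n)
variable (M : Type*) [AddCommGroup M] [Module k M]
  [Module (MvPolynomial (Fin n) k) M]

/-- A minimal graded free resolution `0 → F_len → ⋯ → F_1 → F_0 → M` of the graded
module `M` (with grading `ℳ`): `F i` is free with basis elements of degrees `tw i j`,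
the maps are degree-preserving, the complex is exact, and all differentials map into
`𝔐 ⬝ F i` (minimality). -/
structure MGFR (ℳ : ℤ → Submodule k M) where
  len : ℕ
  rk : ℕ → ℕ
  tw : (i : ℕ) → Fin (rk i) → ℤ
  rk_top : ∀ i, len < i → rk i = 0
  aug : (Fin (rk 0) → MvPolynomial (Fin n) k) →ₗ[MvPolynomial (Fin n) k] M
  diff : (i : ℕ) → ((Fin (rk (i + 1)) → MvPolynomial (Fin n) k)
      →ₗ[MvPolynomial (Fin n) k] (Fin (rk i) → MvPolynomial (Fin n) k))
  aug_surj : Function.Surjective aug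
  exact_zero : LinearMap.ker aug = LinearMap.range (diff 0)
  exact_succ : ∀ i, LinearMap.ker (diff i) = LinearMap.range (diff (i + 1))
  graded_aug : ∀ (d : ℤ) (v : Fin (rk 0) → MvPolynomial (Fin n) k),
    (∀ j, v j ∈ sPiece k n (d - tw 0 j)) → aug v ∈ ℳ d
  graded_diff : ∀ (i : ℕ) (d : ℤ) (v : Fin (rk (i + 1)) → MvPolynomial (Fin n) k),
    (∀ j, v j ∈ sPiece k n (d - tw (i + 1) j)) → ∀ j, diff i v j ∈ sPiece k n (d - tw i j)
  minimal : ∀ i, LinearMap.range (diff i) ≤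
    (maxIdeal k n) • (⊤ : Submodule (MvPolynomial (Fin n) k)
      (Fin (rk i) → MvPolynomial (Fin n) k))

variable {k n M} {ℳ : ℤ → Submodule k M}

/-- `b_i` : the maximum degree of the generators of `F_i` (`⊥` if `F_i = 0`). -/
def bdeg (res : MGFR k n M ℳ) (i : ℕ) : WithBot ℤ :=
  Finset.univ.sup fun j : Fin (res.rk i) => ((res.tw i j : ℤ) : WithBot ℤ)

/-- The `j`-th syzygy module of `M`, as a submodule of `F_j`. -/
def syzSub (res : MGFR k n M ℳ) : (j : ℕ) →
    Submodule (MvPolynomial (Fin n) k) (Fin (res.rk j) → MvPolynomial (Fin n) k)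
  | 0 => LinearMap.ker res.aug
  | (m + 1) => LinearMap.ker (res.diff m)

/-- The degree-`d` piece of the induced grading on the `j`-th syzygy module. -/
def syzPiece (res : MGFR k n M ℳ) (j : ℕ) (d : ℤ) :
    Submodule k ↥(syzSub res j) :=
  Submodule.comap ((syzSub res j).subtype.restrictScalars k)
    (Submodule.pi Set.univ fun l => sPiece k n (d - res.tw j l))

/-- The dual (transposed) differential, into cohomological degree `i`,
of the complex `Hom(F_•, S)` computing `Ext^•(M, S)`. -/
def extDiffInto (res : MGFR k n M ℳ) : (i : ℕ) →
    (Fin (res.rk (i - 1)) → MvPolynomial (Fin n) k) →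
      (Fin (res.rk i) → MvPolynomial (Fin n) k)
  | 0 => fun _ => 0
  | (m + 1) => fun u j' => ∑ j, res.diff m (Pi.single j' 1) j * u j

/-- `Ext^i_S(M, S)_r ≠ 0`, computed from the given minimal graded free resolution;
the dual basis element of a generator of degree `tw i j` has degree `-tw i j`. -/
def ExtNonzero (res : MGFR k n M ℳ) (i : ℕ) (r : ℤ) : Prop :=
  ∃ u : Fin (res.rk i) → MvPolynomial (Fin n) k,
    (∀ j, u j ∈ sPiece k n (r + res.tw i j)) ∧
    extDiffInto res (i + 1) u = 0 ∧
    ¬ ∃ w : Fin (res.rk (i - 1)) → MvPolynomial (Fin n) k, extDiffInto res i w = u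

end Res

section Red

variable {R : Type*} [CommRing R]

/-- `a` is a reduction of the ideal `mR` : `mR^(r+1) = a * mR^r` for all large `r`. -/
def IsReduction (mR a : Ideal R) : Prop :=
  a ≤ mR ∧ ∃ N, ∀ r ≥ N, mR ^ (r + 1) = a * mR ^ r

/-- `a` is a minimal reduction of `mR`. -/
def IsMinimalReduction (mR a : Ideal R) : Prop :=
  IsReduction mR a ∧ ∀ b, IsReduction mR b → b ≤ a → b = a

/-- The reduction number `r_a` : the least `r` with `mR^(r+1) = a * mR^r`. -/
def redNum (mR a : Ideal R) : ℕ := sInf {r | mR ^ (r + 1) = a * mR ^ r}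

/-- The reduction number: the minimum of `r_a` over all minimal reductions `a` of `mR`. -/
def ringRedNum (mR : Ideal R) : ℕ :=
  sInf {r | ∃ a, IsMinimalReduction mR a ∧ redNum mR a = r}

end Red



/-! ### Elementary facts on degrees -/

theorem mem_sPiece {d : ℤ} {f : MvPolynomial (Fin n) k} :
    f ∈ sPiece k n d ↔ ∀ a ∈ f.support, ((a.degree : ℕ) : ℤ) = d := by
  unfold sPiece
  split_ifs with h
  · rw [mem_homogeneousSubmodule]
    constructor
    · intro hf a ha
      have := hf.degree_eq_sum_deg_support ha
      rw [Finsupp.degree_apply, ← this]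
      omega
    · intro hf a ha
      have := hf a (by simpa using ha)
      rw [← this]
      rw [Finsupp.degree_eq_weight_one]
      simp
      rfl
  · constructor
    · intro hf a ha
      simp at hf
      simp [hf] at ha
    · intro hf
      rw [Submodule.mem_bot]
      by_contra hne
      obtain ⟨a, ha⟩ := Finset.nonempty_iff_ne_empty.mpr (mt support_eq_empty.mp hne)
      have := hf a ha
      omega

theorem sP_mul {d e : ℤ} {f g : MvPolynomial (Fin n) k}
    (hf : f ∈ sPiece k n d) (hg : g ∈ sPiece k n e) : f * g ∈ sPiece k n (d + e) := by
  classical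
  rw [mem_sPiece] at *
  intro a ha
  have := support_mul f g ha
  obtain ⟨b, hb, c, hc, rfl⟩ := Finset.mem_add.mp this
  rw [map_add]
  push_cast
  rw [hf b hb, hg c hc]

theorem sP_X (j : Fin n) : (X j : MvPolynomial (Fin n) k) ∈ sPiece k n 1 := by
  rw [mem_sPiece]
  intro a ha
  rw [support_X] at ha
  rw [Finset.mem_singleton] at ha
  subst ha
  simp

theorem sP_one : (1 : MvPolynomial (Fin n) k) ∈ sPiece k n 0 := by
  rw [mem_sPiece]
  intro a ha
  rw [MvPolynomial.mem_support_iff, MvPolynomial.coeff_one] at ha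
  have : a = 0 := by
    by_contra h
    exact ha (if_neg (Ne.symm h))
  subst this
  simp

theorem sP_pow {d : ℤ} {f : MvPolynomial (Fin n) k} (hf : f ∈ sPiece k n d) (m : ℕ) :
    f ^ m ∈ sPiece k n (m * d) := by
  induction m with
  | zero => simpa using sP_one
  | succ m ih =>
    rw [pow_succ]
    have := sP_mul ih hf
    convert this using 1
    push_cast; ring

theorem sP_prod (T : Finset (Fin n)) :
    (∏ j ∈ T, X j : MvPolynomial (Fin n) k) ∈ sPiece k n T.card := by
  classical
  induction T using Finset.induction_on with
  | empty => simpa using sP_one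
  | insert a s ha ih =>
    rw [Finset.prod_insert ha, Finset.card_insert_of_notMem ha]
    have := sP_mul (sP_X (k := k) a) ih
    convert this using 1
    push_cast; ring

theorem sP_congr {d e : ℤ} {f : MvPolynomial (Fin n) k} (hf : f ∈ sPiece k n d) (h : d = e) :
    f ∈ sPiece k n e := h ▸ hf

theorem sP_comp (f : MvPolynomial (Fin n) k) (m : ℕ) :
    homogeneousComponent m f ∈ sPiece k n m := by
  unfold sPiece
  simp [homogeneousComponent_isHomogeneous]

theorem sP_comp_eq {f : MvPolynomial (Fin n) k} {m : ℕ} (hf : f ∈ sPiece k n m) :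
    homogeneousComponent m f = f := by
  apply homogeneousComponent_eq_self
  unfold sPiece at hf
  simpa using hf

theorem comp_X_mul (j : Fin n) (f : MvPolynomial (Fin n) k) (m : ℕ) :
    homogeneousComponent (m + 1) (X j * f) = X j * homogeneousComponent m f := by
  classical
  ext a
  rw [coeff_homogeneousComponent, coeff_X_mul', coeff_X_mul', coeff_homogeneousComponent]
  by_cases hj : j ∈ a.support
  · have h1 : Finsupp.single j 1 ≤ a := by
      rw [Finsupp.single_le_iff]
      have := Finsupp.mem_support_iff.mp hj
      omega
    have h2 : (a - Finsupp.single j 1).degree + 1 = a.degree := by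
      conv_rhs => rw [← tsub_add_cancel_of_le h1]
      simp
    simp only [hj, if_true]
    by_cases h3 : a.degree = m + 1
    · rw [if_pos h3, if_pos (by omega)]
    · rw [if_neg h3, if_neg (by omega)]
  · simp [hj]

theorem comp_X_mul_zero (j : Fin n) (f : MvPolynomial (Fin n) k) :
    homogeneousComponent 0 (X j * f) = 0 := by
  rw [homogeneousComponent_zero]
  classical
  rw [coeff_X_mul']
  simp

theorem sP_neg {d : ℤ} (hd : d < 0) {f : MvPolynomial (Fin n) k} (hf : f ∈ sPiece k n d) :
    f = 0 := by
  unfold sPiece at hf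
  rw [if_neg (by omega)] at hf
  simpa using hf

theorem split_X {J : Ideal (MvPolynomial (Fin n) k)} (hJ : IsHomog J) (z : Fin n)
    {e : ℤ} {f : MvPolynomial (Fin n) k} (hf : f ∈ sPiece k n e)
    (hfJ : f ∈ J ⊔ Ideal.span {X z}) :
    ∃ u ∈ sPiece k n (e - 1), f - X z * u ∈ J := by
  rcases lt_or_ge e 0 with he | he
  · refine ⟨0, Submodule.zero_mem _, ?_⟩
    rw [sP_neg he hf]; simp
  obtain ⟨m, rfl⟩ := Int.eq_ofNat_of_zero_le he
  obtain ⟨g, hg, h, hh, rfl⟩ := Submodule.mem_sup.mp hfJ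
  obtain ⟨a, rfl⟩ := Ideal.mem_span_singleton'.mp hh
  have h1 := sP_comp_eq hf
  rw [map_add, mul_comm a] at h1
  cases m with
  | zero =>
    refine ⟨0, Submodule.zero_mem _, ?_⟩
    rw [mul_comm a, ← h1, comp_X_mul_zero]
    simpa using hJ g hg 0
  | succ m =>
    refine ⟨homogeneousComponent m a, ?_, ?_⟩
    · exact sP_congr (sP_comp a m) (by push_cast; ring)
    · rw [mul_comm a, ← h1, comp_X_mul]
      simpa using hJ g hg (m + 1)

theorem isHomog_sup_X {J : Ideal (MvPolynomial (Fin n) k)} (hJ : IsHomog J) (z : Fin n) :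
    IsHomog (J ⊔ Ideal.span {X z}) := by
  intro f hf d
  obtain ⟨g, hg, h, hh, rfl⟩ := Submodule.mem_sup.mp hf
  obtain ⟨a, rfl⟩ := Ideal.mem_span_singleton'.mp hh
  rw [map_add]
  apply Submodule.add_mem _ (Ideal.mem_sup_left (hJ g hg d))
  rw [mul_comm a]
  cases d with
  | zero => rw [comp_X_mul_zero]; exact Submodule.zero_mem _
  | succ d =>
    rw [comp_X_mul]
    exact Ideal.mem_sup_right (Ideal.mul_mem_right _ _ (Ideal.subset_span rfl))

/-! ### The Koszul differential on total cochains -/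

/-- sign of `j` relative to `T` -/
def sg (j : Fin n) (T : Finset (Fin n)) : MvPolynomial (Fin n) k :=
  (-1) ^ ((T.filter (fun l => l < j)).card)

/-- Koszul differential. -/
def KD (t : ℕ) (v : Finset (Fin n) → MvPolynomial (Fin n) k) (T : Finset (Fin n)) :
    MvPolynomial (Fin n) k :=
  ∑ j ∈ T, sg j T * (X j ^ t * v (T.erase j))

/-- Transition map. -/
def KT (s : ℕ) (v : Finset (Fin n) → MvPolynomial (Fin n) k) (T : Finset (Fin n)) :
    MvPolynomial (Fin n) k :=
  (∏ j ∈ T, X j) ^ s * v T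

/-- Contracting homotopy. -/
def KH (j : Fin n) (v : Finset (Fin n) → MvPolynomial (Fin n) k) (T : Finset (Fin n)) :
    MvPolynomial (Fin n) k :=
  if j ∈ T then 0 else sg j T * v (insert j T)

theorem sg_sq (j : Fin n) (T : Finset (Fin n)) : (sg j T * sg j T : MvPolynomial (Fin n) k) = 1 := by
  unfold sg
  rw [← mul_pow]; simp

theorem sg_erase_self (j : Fin n) (T : Finset (Fin n)) :
    (sg j (T.erase j) : MvPolynomial (Fin n) k) = sg j T := by
  unfold sg
  congr 2
  ext l
  simp only [Finset.mem_filter, Finset.mem_erase]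
  constructor
  · rintro ⟨⟨_, h⟩, h'⟩; exact ⟨h, h'⟩
  · rintro ⟨h, h'⟩; exact ⟨⟨h'.ne, h⟩, h'⟩

theorem sg_insert_self (j : Fin n) (T : Finset (Fin n)) :
    (sg j (insert j T) : MvPolynomial (Fin n) k) = sg j T := by
  unfold sg
  rw [Finset.filter_insert, if_neg (lt_irrefl j)]

theorem sg_erase_gt {j l : Fin n} (h : j < l) (T : Finset (Fin n)) :
    (sg j (T.erase l) : MvPolynomial (Fin n) k) = sg j T := by
  unfold sg
  congr 2
  ext m
  simp only [Finset.mem_filter, Finset.mem_erase]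
  constructor
  · rintro ⟨⟨_, h⟩, h'⟩; exact ⟨h, h'⟩
  · rintro ⟨h1, h'⟩; exact ⟨⟨(h'.trans h).ne, h1⟩, h'⟩

theorem sg_erase_lt {j l : Fin n} (h : l < j) {T : Finset (Fin n)} (hl : l ∈ T) :
    (sg j (T.erase l) : MvPolynomial (Fin n) k) = - sg j T := by
  unfold sg
  have h1 : (T.erase l).filter (fun m => m < j) = (T.filter (fun m => m < j)).erase l := by
    ext m
    simp only [Finset.mem_filter, Finset.mem_erase]
    tauto
  have h2 : l ∈ T.filter (fun m => m < j) := Finset.mem_filter.mpr ⟨hl, h⟩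
  rw [h1, ← Finset.card_erase_add_one h2, pow_succ]
  ring

theorem sg_insert_gt {j l : Fin n} (h : j < l) (T : Finset (Fin n)) (hl : l ∉ T) :
    (sg j (insert l T) : MvPolynomial (Fin n) k) = sg j T := by
  conv_rhs => rw [← Finset.erase_insert hl]
  rw [sg_erase_gt h]

theorem sg_insert_lt {j l : Fin n} (h : l < j) (T : Finset (Fin n)) (hl : l ∉ T) :
    (sg j (insert l T) : MvPolynomial (Fin n) k) = - sg j T := by
  conv_rhs => rw [← Finset.erase_insert hl]
  rw [sg_erase_lt h (Finset.mem_insert_self _ _), neg_neg]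

theorem sg_anti {j l : Fin n} (h : j ≠ l) {T : Finset (Fin n)} (hj : j ∈ T) (hl : l ∈ T) :
    (sg j T * sg l (T.erase j) : MvPolynomial (Fin n) k) = - (sg l T * sg j (T.erase l)) := by
  rcases lt_or_gt_of_ne h with h | h
  · rw [sg_erase_lt h hj, sg_erase_gt h]; ring
  · rw [sg_erase_lt h hl, sg_erase_gt h]; ring

theorem KD_sub (t : ℕ) (v w : Finset (Fin n) → MvPolynomial (Fin n) k) (T : Finset (Fin n)) :
    KD t (fun T => v T - w T) T = KD t v T - KD t w T := by
  unfold KD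
  rw [← Finset.sum_sub_distrib]
  exact Finset.sum_congr rfl fun j _ => by ring

theorem KD_mul (t : ℕ) (z : MvPolynomial (Fin n) k) (v : Finset (Fin n) → MvPolynomial (Fin n) k)
    (T : Finset (Fin n)) : KD t (fun T => z * v T) T = z * KD t v T := by
  unfold KD
  rw [Finset.mul_sum]
  exact Finset.sum_congr rfl fun j _ => by ring

theorem KD_KT (t s : ℕ) (v : Finset (Fin n) → MvPolynomial (Fin n) k) (T : Finset (Fin n)) :
    KD (t + s) (KT s v) T = KT s (KD t v) T := by
  unfold KD KT
  rw [Finset.mul_sum]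
  refine Finset.sum_congr rfl fun j hj => ?_
  rw [← Finset.mul_prod_erase T _ hj]
  ring

theorem KT_KT (s s' : ℕ) (v : Finset (Fin n) → MvPolynomial (Fin n) k) (T : Finset (Fin n)) :
    KT s' (KT s v) T = KT (s + s') v T := by
  unfold KT; ring

theorem KD_KD (t : ℕ) (v : Finset (Fin n) → MvPolynomial (Fin n) k) (T : Finset (Fin n)) :
    KD t (KD t v) T = 0 := by
  unfold KD
  simp_rw [Finset.mul_sum]
  rw [Finset.sum_sigma']
  refine Finset.sum_involution (fun p _ => ⟨p.2, p.1⟩) ?_ ?_ ?_ ?_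
  · rintro ⟨j, l⟩ h
    simp only [Finset.mem_sigma, Finset.mem_erase] at h
    obtain ⟨hj, hlj, hl⟩ := h
    have := sg_anti (k := k) hlj.symm hj hl
    rw [Finset.erase_right_comm]
    linear_combination (X j ^ t * X l ^ t * v ((T.erase l).erase j)) * this
  · rintro ⟨j, l⟩ h _ heq
    simp only [Finset.mem_sigma, Finset.mem_erase] at h
    simp only [Sigma.mk.injEq] at heq
    exact h.2.1 heq.1
  · rintro ⟨j, l⟩ h
    simp only [Finset.mem_sigma, Finset.mem_erase] at h ⊢
    exact ⟨h.2.2, h.2.1.symm, h.1⟩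
  · rintro ⟨j, l⟩ h
    rfl

theorem KD_mem {B : Ideal (MvPolynomial (Fin n) k)} (t i : ℕ)
    {v : Finset (Fin n) → MvPolynomial (Fin n) k}
    (hv : ∀ T, T.card = i → v T ∈ B) {T : Finset (Fin n)} (hT : T.card = i + 1) :
    KD t v T ∈ B := by
  refine Submodule.sum_mem _ fun j hj => ?_
  refine Ideal.mul_mem_left _ _ (Ideal.mul_mem_left _ _ (hv _ ?_))
  rw [Finset.card_erase_of_mem hj, hT]; rfl

theorem sg_mul_mem {d : ℤ} (j : Fin n) (T : Finset (Fin n)) {f : MvPolynomial (Fin n) k}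
    (hf : f ∈ sPiece k n d) : sg j T * f ∈ sPiece k n d := by
  unfold sg
  rcases neg_one_pow_eq_or (MvPolynomial (Fin n) k) (T.filter (fun l => l < j)).card with h | h
  · rw [h, one_mul]; exact hf
  · rw [h, neg_one_mul]; exact Submodule.neg_mem _ hf

theorem KD_deg {d : ℤ} (t i : ℕ) {v : Finset (Fin n) → MvPolynomial (Fin n) k}
    (hv : ∀ T, T.card = i → v T ∈ sPiece k n (d + t * i)) {T : Finset (Fin n)}
    (hT : T.card = i + 1) : KD t v T ∈ sPiece k n (d + t * (i + 1 : ℕ)) := by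
  refine Submodule.sum_mem _ fun j hj => ?_
  refine sg_mul_mem _ _ ?_
  have h1 := hv (T.erase j) (by rw [Finset.card_erase_of_mem hj, hT]; rfl)
  refine sP_congr (sP_mul (sP_pow (sP_X j) t) h1) ?_
  push_cast; ring

theorem KT_deg {d : ℤ} (t s i : ℕ) {v : Finset (Fin n) → MvPolynomial (Fin n) k}
    (hv : ∀ T, T.card = i → v T ∈ sPiece k n (d + t * i)) {T : Finset (Fin n)}
    (hT : T.card = i) : KT s v T ∈ sPiece k n (d + (t + s : ℕ) * i) := by
  refine sP_congr (sP_mul (sP_pow (sP_prod T) s) (hv T hT)) ?_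
  rw [hT]; push_cast; ring

theorem KT_mem {B : Ideal (MvPolynomial (Fin n) k)} (s : ℕ)
    {v : Finset (Fin n) → MvPolynomial (Fin n) k} {T : Finset (Fin n)}
    (hv : v T ∈ B) : KT s v T ∈ B := Ideal.mul_mem_left _ _ hv

theorem KD_KH (t : ℕ) (j : Fin n) (v : Finset (Fin n) → MvPolynomial (Fin n) k)
    (T : Finset (Fin n)) : KD t (KH j v) T + KH j (KD t v) T = X j ^ t * v T := by
  by_cases hj : j ∈ T
  · have h1 : KH j (KD t v) T = 0 := if_pos hj
    rw [h1, add_zero]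
    unfold KD
    rw [Finset.sum_eq_single_of_mem j hj]
    · unfold KH
      rw [if_neg (Finset.notMem_erase j T), Finset.insert_erase hj, sg_erase_self]
      linear_combination (X j ^ t * v T) * sg_sq (k := k) j T
    · intro l hl hlj
      unfold KH
      rw [if_pos (Finset.mem_erase.mpr ⟨hlj.symm, hj⟩)]
      ring
  · have h1 : KH j (KD t v) T = sg j T * KD t v (insert j T) := if_neg hj
    rw [h1]
    unfold KD
    rw [Finset.sum_insert hj, Finset.erase_insert hj, sg_insert_self, mul_add, add_left_comm,
      Finset.mul_sum, ← Finset.sum_add_distrib, Finset.sum_eq_zero]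
    · linear_combination (X j ^ t * v T) * sg_sq (k := k) j T
    · intro l hl
      have hlj : l ≠ j := fun h => hj (h ▸ hl)
      unfold KH
      rw [if_neg (fun h => hj (Finset.mem_of_mem_erase h)),
        Finset.erase_insert_of_ne hlj.symm]
      have h3 : (sg l T * sg j (T.erase l) + sg j T * sg l (insert j T) :
          MvPolynomial (Fin n) k) = 0 := by
        rcases lt_or_gt_of_ne hlj with h | h
        · rw [sg_erase_lt h hl, sg_insert_gt h _ hj]; ring
        · rw [sg_erase_gt h, sg_insert_lt h _ hj]; ring
      linear_combination (X l ^ t * v (insert j (T.erase l))) * h3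


/-! ### Vanishing of local cohomology of subquotients `A/B` of `S` -/

/-- `H^i(A/B)_d = 0`, for ideals `A`, `B` of the polynomial ring. -/
def van (A B : Ideal (MvPolynomial (Fin n) k)) (i : ℕ) (d : ℤ) : Prop :=
  ∀ (t : ℕ) (v : Finset (Fin n) → MvPolynomial (Fin n) k),
    (∀ T, T.card = i → v T ∈ A) →
    (∀ T, T.card = i → v T ∈ sPiece k n (d + t * i)) →
    (∀ T, T.card = i + 1 → KD t v T ∈ B) →
    ∃ (s : ℕ) (w : Finset (Fin n) → MvPolynomial (Fin n) k),
      (∀ i', i' + 1 = i → ∀ T, T.card = i' →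
        w T ∈ A ∧ w T ∈ sPiece k n (d + (t + s : ℕ) * i')) ∧
      ∀ T, T.card = i → KT s v T - KD (t + s) w T ∈ B

/-- multiplication by `z` is injective on `S/J` in degrees `> c`. -/
def Cinj (J : Ideal (MvPolynomial (Fin n) k)) (z : Fin n) (c : ℤ) : Prop :=
  ∀ d > c, ∀ f ∈ sPiece k n d, X z * f ∈ J → f ∈ J

theorem van_quot_of {J : Ideal (MvPolynomial (Fin n) k)} (hJ : IsHomog J) (z : Fin n) {c : ℤ}
    (hc : Cinj J z c) (i : ℕ) (d : ℤ) (h0 : van ⊤ J i d) (h1 : van ⊤ J (i + 1) (d - 1)) :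
    van ⊤ (J ⊔ Ideal.span {X z}) i d := by
  intro t v _ hvd hvc
  have key : ∀ T : Finset (Fin n), ∃ u : MvPolynomial (Fin n) k, T.card = i + 1 →
      u ∈ sPiece k n (d - 1 + t * (i + 1 : ℕ)) ∧ KD t v T - X z * u ∈ J := by
    intro T
    by_cases hT : T.card = i + 1
    · obtain ⟨u, hu, hu'⟩ := split_X hJ z (KD_deg t i hvd hT) (hvc T hT)
      exact ⟨u, fun _ => ⟨sP_congr hu (by ring), hu'⟩⟩
    · exact ⟨0, fun h => absurd h hT⟩
  choose u hu using key
  -- choose `s` large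
  obtain ⟨s, hs⟩ : ∃ s : ℕ, c < d - 1 + (t + s : ℕ) * (i + 2 : ℕ) := by
    refine ⟨(c - d + 1).toNat + 1, ?_⟩
    have h1 := Int.self_le_toNat (c - d + 1)
    push_cast
    nlinarith [mul_nonneg (Int.natCast_nonneg t) (Int.natCast_nonneg i),
      mul_nonneg (Int.natCast_nonneg ((c - d + 1).toNat)) (Int.natCast_nonneg i)]
  have hu1 : ∀ T, T.card = i + 2 → KD (t + s) (KT s u) T ∈ J := by
    intro T hT
    refine hc _ hs _ (KD_deg (t + s) (i + 1)
      (fun T' hT' => KT_deg t s (i + 1) (fun T h => (hu T h).1) hT') hT) ?_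
    rw [KD_KT]
    have h2 : X z * KD t u T ∈ J := by
      rw [← KD_mul]
      have h3 : KD t (fun T => KD t v T - X z * u T) T ∈ J :=
        KD_mem t (i + 1) (fun T' hT' => (hu T' hT').2) hT
      rw [KD_sub, KD_KD, zero_sub] at h3
      exact (Submodule.neg_mem_iff _).mp h3
    unfold KT
    rw [mul_left_comm]
    exact Ideal.mul_mem_left _ _ h2
  obtain ⟨s', w, hw, hw'⟩ := h1 (t + s) (KT s u) (fun _ _ => Submodule.mem_top)
    (fun T hT => KT_deg t s (i + 1) (fun T h => (hu T h).1) hT) hu1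
  have hy : ∀ T, T.card = i → KT (s + s') v T - X z * w T ∈
      sPiece k n (d + (t + (s + s') : ℕ) * i) := by
    intro T hT
    refine Submodule.sub_mem _ (KT_deg t (s + s') i hvd hT) ?_
    refine sP_congr (sP_mul (sP_X z) (hw i rfl T hT).2) ?_
    push_cast; ring
  obtain ⟨s'', p, hp, hp'⟩ := h0 (t + (s + s')) (fun T => KT (s + s') v T - X z * w T)
    (fun _ _ => Submodule.mem_top) hy (by
      intro T hT
      rw [KD_sub, KD_mul, KD_KT]
      have e1 : KT (s + s') (KD t v) T - KT (s + s') (fun T => X z * u T) T ∈ J := by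
        unfold KT
        rw [← mul_sub]
        exact Ideal.mul_mem_left _ _ (hu T hT).2
      have e2 := Ideal.mul_mem_left J (X z) (hw' T hT)
      rw [KT_KT, add_assoc t] at e2
      have := Submodule.add_mem _ e1 e2
      convert this using 1
      unfold KT
      ring)
  refine ⟨(s + s') + s'', p, fun i' hi' T hT => ⟨Submodule.mem_top, ?_⟩, fun T hT => ?_⟩
  · refine sP_congr (hp i' hi' T hT).2 ?_
    push_cast; ring
  · have e1 := Ideal.mem_sup_left (T := Ideal.span {X z}) (hp' T hT)
    have e2 : (∏ j ∈ T, X j) ^ s'' * (X z * w T) ∈ J ⊔ Ideal.span {X z} :=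
      Ideal.mem_sup_right (Ideal.mul_mem_left _ _ (Ideal.mul_mem_right _ _ (Ideal.subset_span rfl)))
    have := Submodule.add_mem _ e1 e2
    rw [← add_assoc t]
    convert this using 1
    rw [← KT_KT]
    unfold KT
    ring

/-- `v` becomes a coboundary modulo `J` after transition. -/
def triv (J : Ideal (MvPolynomial (Fin n) k)) (i : ℕ) (d : ℤ) (t : ℕ)
    (v : Finset (Fin n) → MvPolynomial (Fin n) k) : Prop :=
  ∃ (s : ℕ) (w : Finset (Fin n) → MvPolynomial (Fin n) k),
      (∀ T, T.card = i → w T ∈ sPiece k n (d + (t + s : ℕ) * i)) ∧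
      ∀ T, T.card = i + 1 → KT s v T - KD (t + s) w T ∈ J

theorem triv_of_mul {J : Ideal (MvPolynomial (Fin n) k)} (hJ : IsHomog J) (z : Fin n) {c : ℤ}
    (hc : Cinj J z c) (i : ℕ) (d : ℤ) (h1 : van ⊤ (J ⊔ Ideal.span {X z}) i d) (t : ℕ)
    (v : Finset (Fin n) → MvPolynomial (Fin n) k)
    (hvd : ∀ T, T.card = i + 1 → v T ∈ sPiece k n (d - 1 + t * (i + 1 : ℕ)))
    (hvc : ∀ T, T.card = i + 2 → KD t v T ∈ J)
    (hz : triv J i d t (fun T => X z * v T)) : triv J i (d - 1) t v := by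
  obtain ⟨s, w, hw, hw'⟩ := hz
  have hz' : (X z : MvPolynomial (Fin n) k) ∈ J ⊔ Ideal.span {X z} :=
    Ideal.mem_sup_right (Ideal.subset_span rfl)
  obtain ⟨s', u, hu, hu'⟩ := h1 (t + s) w (fun _ _ => Submodule.mem_top) hw (by
    intro T hT
    have e1 := Ideal.mem_sup_left (T := Ideal.span {X z}) (hw' T hT)
    have e2 : KT s (fun T => X z * v T) T ∈ J ⊔ Ideal.span {X z} :=
      KT_mem s (Ideal.mul_mem_right _ _ hz')
    have := Submodule.sub_mem _ e2 e1
    simpa using this)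
  -- `w = δ u + z q`
  have hdu : ∀ T, T.card = i → KD (t + s + s') u T ∈ sPiece k n (d + (t + s + s' : ℕ) * i) := by
    intro T hT
    cases i with
    | zero =>
      have : T = ∅ := Finset.card_eq_zero.mp hT
      subst this
      simp [KD]
    | succ i' => exact KD_deg _ i' (fun T hT => (hu i' rfl T hT).2) hT
  have key : ∀ T : Finset (Fin n), ∃ q : MvPolynomial (Fin n) k, T.card = i →
      q ∈ sPiece k n (d - 1 + (t + s + s' : ℕ) * i) ∧
        KT s' w T - KD (t + s + s') u T - X z * q ∈ J := by
    intro T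
    by_cases hT : T.card = i
    · obtain ⟨q, hq, hq'⟩ := split_X hJ z
        (Submodule.sub_mem _ (KT_deg (t + s) s' i hw hT) (hdu T hT)) (hu' T hT)
      exact ⟨q, fun _ => ⟨sP_congr hq (by ring), hq'⟩⟩
    · exact ⟨0, fun h => absurd h hT⟩
  choose q hq using key
  obtain ⟨s'', hs⟩ : ∃ s'' : ℕ, c < d - 1 + (t + (s + s') + s'' : ℕ) * (i + 1 : ℕ) := by
    refine ⟨(c - d + 1).toNat + 1, ?_⟩
    have h1 := Int.self_le_toNat (c - d + 1)
    push_cast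
    nlinarith [mul_nonneg (Int.natCast_nonneg t) (Int.natCast_nonneg i),
      mul_nonneg (Int.natCast_nonneg s) (Int.natCast_nonneg i),
      mul_nonneg (Int.natCast_nonneg s') (Int.natCast_nonneg i),
      mul_nonneg (Int.natCast_nonneg ((c - d + 1).toNat)) (Int.natCast_nonneg i)]
  have hr : ∀ T, T.card = i + 1 → KT (s + s') v T - KD (t + s + s') q T ∈
      sPiece k n (d - 1 + (t + (s + s') : ℕ) * (i + 1 : ℕ)) := by
    intro T hT
    refine Submodule.sub_mem _ (KT_deg t (s + s') (i + 1) hvd hT) ?_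
    rw [← add_assoc t]
    exact KD_deg _ i (fun T hT => (hq T hT).1) hT
  have hzr : ∀ T, T.card = i + 1 → X z * (KT (s + s') v T - KD (t + s + s') q T) ∈ J := by
    intro T hT
    have e1 : KT s' (fun T => KT s (fun T => X z * v T) T - KD (t + s) w T) T ∈ J :=
      KT_mem s' (hw' T hT)
    have e2 : KD (t + s + s') (fun T => KT s' w T - KD (t + s + s') u T - X z * q T) T ∈ J :=
      KD_mem _ i (fun T hT => (hq T hT).2) hT
    rw [KD_sub, KD_sub, KD_KD, KD_mul, KD_KT] at e2
    have := Submodule.add_mem _ e1 e2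
    convert this using 1
    unfold KT
    ring
  refine ⟨(s + s') + s'', KT s'' q, ?_, ?_⟩
  · intro T hT
    rw [← add_assoc t, ← add_assoc t]
    exact KT_deg (t + s + s') s'' i (fun T h => (hq T h).1) hT
  · intro T hT
    have e1 := hc _ hs _ (KT_deg (t + (s + s')) s'' (i + 1) hr hT) (by
      unfold KT
      rw [mul_left_comm]
      exact Ideal.mul_mem_left _ _ (hzr T hT))
    rw [← add_assoc t, ← add_assoc t, KD_KT, ← KT_KT]
    convert e1 using 1
    unfold KT
    ring

theorem van_succ_of {J : Ideal (MvPolynomial (Fin n) k)} (hJ : IsHomog J) (z : Fin n) {c : ℤ}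
    (hc : Cinj J z c) (i : ℕ) (d : ℤ)
    (h1 : ∀ e > d, van ⊤ (J ⊔ Ideal.span {X z}) i e) :
    van ⊤ J (i + 1) d := by
  intro t v _ hvd hvc
  have main : ∀ m : ℕ, m ≤ t → triv J i (d + (t - m : ℕ)) t (fun T => X z ^ (t - m) * v T) := by
    intro m
    induction m with
    | zero =>
      intro _
      refine ⟨0, KH z v, ?_, ?_⟩
      · intro T hT
        unfold KH
        split_ifs with hz
        · exact Submodule.zero_mem _
        · refine sg_mul_mem _ _ ?_
          refine sP_congr (hvd _ (by rw [Finset.card_insert_of_notMem hz, hT])) ?_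
          push_cast
          simp
          ring
      · intro T hT
        have e1 := KD_KH t z v T
        have e2 : KH z (KD t v) T ∈ J := by
          unfold KH
          split_ifs with hz
          · exact Submodule.zero_mem _
          · exact Ideal.mul_mem_left _ _
              (hvc _ (by rw [Finset.card_insert_of_notMem hz, hT]))
        convert e2 using 1
        simp only [KT, Nat.sub_zero, add_zero, pow_zero, one_mul]
        rw [← e1]; ring
    | succ m ih =>
      intro hm
      have h2 := ih (by omega)
      obtain ⟨r, hr⟩ : ∃ r, t - m = r + 1 := ⟨t - m - 1, by omega⟩
      have hr' : t - (m + 1) = r := by omega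
      rw [hr] at h2
      rw [hr']
      have h3 := triv_of_mul hJ z hc i (d + (r + 1 : ℕ)) (h1 _ (by push_cast; omega)) t
        (fun T => X z ^ r * v T) ?_ ?_ ?_
      · have e : d + ((r + 1 : ℕ) : ℤ) - 1 = d + r := by push_cast; ring
        rwa [e] at h3
      · intro T hT
        refine sP_congr (sP_mul (sP_pow (sP_X z) r) (hvd T hT)) ?_
        push_cast; ring
      · intro T hT
        rw [KD_mul]
        exact Ideal.mul_mem_left _ _ (hvc T hT)
      · convert h2 using 2
        ring
  obtain ⟨s, w, hw, hw'⟩ := main t le_rfl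
  refine ⟨s, w, ?_, ?_⟩
  · intro i' hi' T hT
    obtain rfl : i' = i := by omega
    refine ⟨Submodule.mem_top, sP_congr (hw T hT) ?_⟩
    simp
  · intro T hT
    have := hw' T hT
    simpa [KT] using this

theorem van_zero_iff {J : Ideal (MvPolynomial (Fin n) k)} (d : ℤ) :
    van ⊤ J 0 d ↔ ∀ f ∈ sPiece k n d, (∃ t : ℕ, ∀ j : Fin n, X j ^ t * f ∈ J) → f ∈ J := by
  constructor
  · rintro h f hf ⟨t, ht⟩
    obtain ⟨s, w, -, hw⟩ := h t (fun _ => f) (fun _ _ => Submodule.mem_top)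
      (fun _ _ => by simpa using hf) (by
        intro T hT
        refine Submodule.sum_mem _ fun j hj => Ideal.mul_mem_left _ _ (ht j))
    simpa [KT, KD] using hw ∅ rfl
  · intro h t v _ hvd hvc
    refine ⟨0, 0, by omega, ?_⟩
    intro T hT
    have hT' : T = ∅ := Finset.card_eq_zero.mp hT
    subst hT'
    have := h (v ∅) (by simpa using hvd ∅ rfl) ⟨t, fun j => by
      have := hvc {j} rfl
      simpa [KD, sg, Finset.filter_singleton] using this⟩
    simpa [KT, KD] using this

theorem van_zero_iff_Cinj {J : Ideal (MvPolynomial (Fin n) k)} (z : Fin n) {c : ℤ}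
    (hc : Cinj J z c) (b : ℤ) : (∀ d > b, van ⊤ J 0 d) ↔ Cinj J z b := by
  constructor
  · intro h d hd f hf hzf
    refine (van_zero_iff d).mp (h d hd) f hf ⟨(c - d).toNat + 1, fun j => ?_⟩
    refine hc (((c - d).toNat + 1 : ℕ) * 1 + d) ?_ _ (sP_mul (sP_pow (sP_X j) _) hf) ?_
    · have := Int.self_le_toNat (c - d)
      push_cast
      omega
    · rw [mul_left_comm]
      exact Ideal.mul_mem_left _ _ hzf
  · intro h d hd
    rw [van_zero_iff]
    rintro f hf ⟨t, ht⟩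
    have main : ∀ r : ℕ, ∀ e > b, ∀ g ∈ sPiece k n e, X z ^ r * g ∈ J → g ∈ J := by
      intro r
      induction r with
      | zero => intro e _ g _ hg; simpa using hg
      | succ r ih =>
        intro e he g hg hzg
        refine h e he g hg (ih (1 + e) (by omega) _ (sP_mul (sP_X z) hg) ?_)
        rwa [← mul_assoc, ← pow_succ]
    exact main t d hd f hf (ht z)

/-- Vanishing of `H^i(S/J)` in degrees `> b i`, for all `i < t`. -/
def VV (J : Ideal (MvPolynomial (Fin n) k)) (t : ℕ) (b : ℕ → ℤ) : Prop :=
  ∀ i < t, ∀ d > b i, van ⊤ J i d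

theorem VV_step {J : Ideal (MvPolynomial (Fin n) k)} (hJ : IsHomog J) (z : Fin n) {c : ℤ}
    (hc : Cinj J z c) (t : ℕ) (b : ℕ → ℤ) (hb : ∀ i, b i ≤ b (i + 1) + 1) :
    VV J (t + 1) b ↔ Cinj J z (b 0) ∧
      VV (J ⊔ Ideal.span {X z}) t (fun i => b (i + 1) + 1) := by
  rw [← van_zero_iff_Cinj z hc]
  constructor
  · intro h
    refine ⟨h 0 (by omega), fun i hi d hd => ?_⟩
    have := hb i
    have hd' : d > b (i + 1) + 1 := hd
    exact van_quot_of hJ z hc i d (h i (by omega) d (by omega))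
      (h (i + 1) (by omega) (d - 1) (by omega))
  · rintro ⟨h0, h1⟩ i hi d hd
    cases i with
    | zero => exact h0 d hd
    | succ i =>
      exact van_succ_of hJ z hc i d fun e he => h1 i (by omega) e (by show e > b (i+1) + 1; omega)

/-! ### From `S/I` to `I` -/

theorem van_ideal_zero (I : Ideal (MvPolynomial (Fin n) k)) (d : ℤ) (h : van (k := k) (n := n) ⊤ ⊥ 0 d) :
    van I ⊥ 0 d := by
  intro t v _ hvd hvc
  obtain ⟨s, w, _, hw⟩ := h t v (fun _ _ => Submodule.mem_top) hvd hvc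
  exact ⟨s, w, by omega, hw⟩

theorem van_quot_of_ideal (I : Ideal (MvPolynomial (Fin n) k)) (i : ℕ) (d : ℤ)
    (h0 : van (k := k) (n := n) ⊤ ⊥ i d) (h1 : van I ⊥ (i + 1) d) : van ⊤ I i d := by
  intro t v _ hvd hvc
  obtain ⟨s, w, hw, hw'⟩ := h1 t (KD t v) hvc (fun T hT => KD_deg t i hvd hT)
    (fun T _ => by rw [KD_KD]; exact Submodule.zero_mem _)
  obtain ⟨s', y, hy, hy'⟩ := h0 (t + s) (fun T => KT s v T - w T) (fun _ _ => Submodule.mem_top)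
    (fun T hT => Submodule.sub_mem _ (KT_deg t s i hvd hT) (hw i rfl T hT).2) (by
      intro T hT
      rw [KD_sub, KD_KT]
      exact hw' T hT)
  refine ⟨s + s', y, fun i' hi' T hT => ?_, fun T hT => ?_⟩
  · rw [← add_assoc t]
    exact hy i' hi' T hT
  · have e1 : KT s' (fun T => KT s v T - w T) T - KD (t + s + s') y T ∈ I := by
      rw [(Submodule.mem_bot _).mp (hy' T hT)]
      exact Submodule.zero_mem _
    have e2 : KT s' w T ∈ I := KT_mem s' (hw i rfl T hT).1
    have := Submodule.add_mem _ e1 e2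
    rw [← add_assoc t]
    convert this using 1
    rw [← KT_KT]
    unfold KT
    ring

theorem van_ideal_of_quot (I : Ideal (MvPolynomial (Fin n) k)) (i : ℕ) (d : ℤ)
    (h0 : van (k := k) (n := n) ⊤ ⊥ (i + 1) d) (h1 : van ⊤ I i d) : van I ⊥ (i + 1) d := by
  intro t v hvI hvd hvc
  obtain ⟨s, w, hw, hw'⟩ := h0 t v (fun _ _ => Submodule.mem_top) hvd hvc
  obtain ⟨s', u, hu, hu'⟩ := h1 (t + s) w (fun _ _ => Submodule.mem_top)
    (fun T hT => (hw i rfl T hT).2) (by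
      intro T hT
      rw [← sub_eq_zero.mp ((Submodule.mem_bot _).mp (hw' T hT))]
      exact KT_mem s (hvI T hT))
  have hdu : ∀ T, T.card = i → KD (t + s + s') u T ∈ sPiece k n (d + (t + s + s' : ℕ) * i) := by
    intro T hT
    cases i with
    | zero =>
      have : T = ∅ := Finset.card_eq_zero.mp hT
      subst this
      simp [KD]
    | succ i' => exact KD_deg _ i' (fun T hT => (hu i' rfl T hT).2) hT
  refine ⟨s + s', fun T => KT s' w T - KD (t + s + s') u T, ?_, ?_⟩
  · intro i' hi' T hT
    obtain rfl : i' = i := by omega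
    refine ⟨hu' T hT, ?_⟩
    rw [← add_assoc t]
    exact Submodule.sub_mem _ (KT_deg (t + s) s' i' (fun T hT => (hw i' rfl T hT).2) hT) (hdu T hT)
  · intro T hT
    rw [← add_assoc t, KD_sub, KD_KD, KD_KT, sub_zero, ← KT_KT]
    have := sub_eq_zero.mp ((Submodule.mem_bot _).mp (hw' T hT))
    unfold KT at *
    rw [this]
    simp


/-! ### Iteration over the variables -/

/-- `I + (last m variables)` -/
def JJ (I : Ideal (MvPolynomial (Fin n) k)) (m : ℕ) : Ideal (MvPolynomial (Fin n) k) :=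
  I ⊔ Ideal.span (X '' {j : Fin n | n ≤ (j : ℕ) + m})

/-- the variable `x_{n-l}` (1-based), i.e. the `l`-th element of the reversed sequence. -/
def zz {l : ℕ} (h : l < n) : Fin n := ⟨n - 1 - l, by omega⟩

theorem JJ_zero (I : Ideal (MvPolynomial (Fin n) k)) : JJ I 0 = I := by
  unfold JJ
  have : {j : Fin n | n ≤ (j : ℕ) + 0} = ∅ := by
    ext j
    have := j.2
    simp
  rw [this]
  simp

theorem JJ_succ (I : Ideal (MvPolynomial (Fin n) k)) {m : ℕ} (h : m < n) :
    JJ I (m + 1) = JJ I m ⊔ Ideal.span {X (zz h)} := by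
  unfold JJ
  have : {j : Fin n | n ≤ (j : ℕ) + (m + 1)} = {j : Fin n | n ≤ (j : ℕ) + m} ∪ {zz h} := by
    ext j
    have := j.2
    simp only [Set.mem_ofPred_eq, Set.mem_union, Set.mem_singleton_iff, Fin.ext_iff, zz]
    omega
  rw [this, Set.image_union, Set.image_singleton, Ideal.span_union, sup_assoc]

theorem JJ_homog {I : Ideal (MvPolynomial (Fin n) k)} (hI : IsHomog I) (m : ℕ) (hm : m ≤ n) :
    IsHomog (JJ I m) := by
  induction m with
  | zero => rwa [JJ_zero]
  | succ m ih =>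
    rw [JJ_succ I hm]
    exact isHomog_sup_X (ih (by omega)) _

/-- Filter regularity in the form used below. -/
def FRI (I : Ideal (MvPolynomial (Fin n) k)) : Prop :=
  ∀ (l : ℕ) (h : l < n), ∃ c : ℤ, Cinj (JJ I l) (zz h) c

theorem VV_iter {I : Ideal (MvPolynomial (Fin n) k)} (hI : IsHomog I) (hfr : FRI I) (m : ℕ) :
    m ≤ n → ∀ (t : ℕ) (b : ℕ → ℤ), (∀ i, b i ≤ b (i + 1) + 1) →
    (VV I (m + t) b ↔ (∀ (l : ℕ) (h : l < n), l < m → Cinj (JJ I l) (zz h) (b l + l)) ∧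
      VV (JJ I m) t (fun i => b (i + m) + m)) := by
  induction m with
  | zero =>
    intro _ t b _
    simp [JJ_zero]
  | succ m ih =>
    intro hm t b hb
    have e : m + 1 + t = m + (t + 1) := by ring
    obtain ⟨c, hc⟩ := hfr m hm
    rw [e, ih (by omega) (t + 1) b hb, VV_step (JJ_homog hI m (by omega)) (zz hm) hc t _
      (fun i => by
        have := hb (i + m)
        rw [show i + 1 + m = i + m + 1 by ring]
        omega), ← JJ_succ I hm]
    have e2 : (fun i => b (i + 1 + m) + (m : ℤ) + 1) =
        (fun i => b (i + (m + 1)) + ((m + 1 : ℕ) : ℤ)) := by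
      funext i
      rw [show i + 1 + m = i + (m + 1) by ring]
      push_cast; ring
    rw [e2, ← and_assoc]
    refine and_congr_left fun _ => ?_
    constructor
    · rintro ⟨h1, h2⟩ l h hl
      rcases Nat.lt_succ_iff_lt_or_eq.mp hl with h' | rfl
      · exact h1 l h h'
      · simpa using h2
    · intro h1
      refine ⟨fun l h hl => h1 l h (by omega), ?_⟩
      simpa using h1 m hm (by omega)

theorem Cinj_bot (l : ℕ) (h : l < n) (c : ℤ) :
    Cinj (JJ (⊥ : Ideal (MvPolynomial (Fin n) k)) l) (zz h) c := by
  classical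
  intro d _ f _ hzf
  unfold JJ at *
  rw [bot_sup_eq, mem_ideal_span_X_image] at *
  intro a ha
  obtain ⟨i, hi, hi'⟩ := hzf (Finsupp.single (zz h) 1 + a) (by
    rw [MvPolynomial.mem_support_iff, coeff_X_mul]
    exact MvPolynomial.mem_support_iff.mp ha)
  refine ⟨i, hi, ?_⟩
  have : zz h ≠ i := by
    rintro rfl
    simp only [Set.mem_ofPred_eq, zz] at hi
    omega
  simpa [Finsupp.single_apply, this] using hi'

theorem isHomog_bot : IsHomog (⊥ : Ideal (MvPolynomial (Fin n) k)) := by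
  intro f hf d
  rw [(Submodule.mem_bot _).mp hf]
  simp

theorem VV_bot (b : ℕ → ℤ) (hb : ∀ i, b i ≤ b (i + 1) + 1) :
    VV (⊥ : Ideal (MvPolynomial (Fin n) k)) n b := by
  have := (VV_iter (k := k) isHomog_bot (fun l h => ⟨0, Cinj_bot l h 0⟩) n le_rfl 0 b hb).mpr
    ⟨fun l h _ => Cinj_bot l h _, fun i hi => absurd hi (by omega)⟩
  exact this

theorem van_bot_lt (i : ℕ) (hi : i < n) (d : ℤ) :
    van (⊤ : Ideal (MvPolynomial (Fin n) k)) ⊥ i d :=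
  VV_bot (fun _ => d - 1) (fun _ => by omega) i hi d (by show d > d - 1; omega)

theorem van_bot_top (d : ℤ) (hd : -(n : ℤ) < d) :
    van (⊤ : Ideal (MvPolynomial (Fin n) k)) ⊥ n d := by
  have := (VV_iter (k := k) (n := n) isHomog_bot (fun l h => ⟨0, Cinj_bot l h 0⟩) n le_rfl 1
    (fun _ => -(n : ℤ)) (fun _ => by omega)).mpr
    ⟨fun l h _ => Cinj_bot l h _, ?_⟩
  · exact this n (by omega) d hd
  · intro i hi e he
    obtain rfl : i = 0 := by omega
    have he' : e > 0 := by
      have : e > -(n : ℤ) + n := he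
      omega
    rw [van_zero_iff]
    intro f hf _
    unfold JJ
    rw [bot_sup_eq, mem_ideal_span_X_image]
    intro a ha
    have h1 := mem_sPiece.mp hf a ha
    by_contra hcon
    push Not at hcon
    have : a = 0 := by
      ext j
      simpa using hcon j (by simp)
    subst this
    simp at h1
    omega

theorem not_van_top {J : Ideal (MvPolynomial (Fin n) k)} (hJ : IsHomog J) (hne : J ≠ ⊥) :
    ¬ van J ⊥ n (-(n : ℤ)) := by
  classical
  obtain ⟨g, hg, hg0⟩ := Submodule.exists_mem_ne_zero_of_ne_bot hne
  obtain ⟨m0, hm0⟩ := Finset.nonempty_iff_ne_empty.mpr (mt support_eq_empty.mp hg0)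
  set f := homogeneousComponent m0.degree g with hf
  have hfJ : f ∈ J := hJ g hg _
  have hfd : f ∈ sPiece k n m0.degree := sP_comp _ _
  have hfm : coeff m0 f ≠ 0 := by
    rw [hf, coeff_homogeneousComponent, if_pos rfl]
    exact MvPolynomial.mem_support_iff.mp hm0
  set r := m0.degree with hr
  set one : Fin n →₀ ℕ := Finsupp.equivFunOnFinite.symm (fun _ => 1) with hone
  have hle : m0 ≤ r • one := by
    intro j
    simp only [hone, Finsupp.smul_apply, Finsupp.equivFunOnFinite_symm_apply_apply, smul_eq_mul, mul_one]
    exact Finsupp.le_degree j m0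
  have honed : (one.degree : ℕ) = n := by
    rw [Finsupp.degree_eq_sum]
    simp [hone]
  intro h
  obtain ⟨s, w, -, hw⟩ := h (r + 1) (fun _ => monomial (r • one - m0) 1 * f)
    (fun _ _ => Ideal.mul_mem_left _ _ hfJ) (by
      intro T hT
      have h1 : (monomial (r • one - m0) 1 : MvPolynomial (Fin n) k) ∈
          sPiece k n ((r • one - m0).degree : ℕ) := by
        rw [mem_sPiece]
        intro a ha
        have := support_monomial_subset ha
        rw [Finset.mem_singleton] at this
        rw [this]
      refine sP_congr (sP_mul h1 hfd) ?_
      have h2 : (r • one - m0).degree + r = r * n := by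
        conv_lhs => rw [hr]
        rw [← map_add, tsub_add_cancel_of_le hle, map_nsmul, honed]
        simp
      have h3 : (((r • one - m0).degree : ℕ) : ℤ) + r = r * n := by exact_mod_cast h2
      rw [h3]; push_cast; ring) (by
      intro T hT
      have := Finset.card_le_univ T
      simp at this
      omega)
  have h1 := sub_eq_zero.mp ((Submodule.mem_bot _).mp (hw Finset.univ (by simp)))
  have h2 := congrArg (coeff ((r + s) • one)) h1
  have h3 : coeff ((r + s) • one) (KD (r + 1 + s) w Finset.univ) = 0 := by
    unfold KD
    rw [coeff_sum]
    refine Finset.sum_eq_zero fun j _ => ?_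
    rw [mul_left_comm, X_pow_eq_monomial, coeff_monomial_mul', if_neg]
    intro hcon
    have := hcon j
    simp [hone] at this
  rw [h3] at h2
  have h4 : (∏ j : Fin n, X j : MvPolynomial (Fin n) k) = monomial one 1 := by
    rw [monomial_eq]
    simp [hone, Finsupp.prod_fintype]
  unfold KT at h2
  rw [h4, monomial_pow, one_pow, ← mul_assoc, monomial_mul, one_mul] at h2
  have h5 : (r + s) • one = (s • one + (r • one - m0)) + m0 := by
    rw [add_assoc, tsub_add_cancel_of_le hle, add_smul, add_comm]
  rw [h5, coeff_monomial_mul, one_mul] at h2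
  exact hfm h2

/-- Vanishing of `H^i(I)` in degrees `> b i`, for all `i < t`. -/
def WW (I : Ideal (MvPolynomial (Fin n) k)) (t : ℕ) (b : ℕ → ℤ) : Prop :=
  ∀ i < t, ∀ d > b i, van I ⊥ i d

theorem WW_iff {I : Ideal (MvPolynomial (Fin n) k)} (hI : IsHomog I) (hne : I ≠ ⊥)
    (t : ℕ) (ht : t ≤ n) (b : ℕ → ℤ) :
    WW I (t + 1) b ↔ VV I t (fun i => b (i + 1)) ∧ (t = n → -(n : ℤ) ≤ b n) := by
  constructor
  · intro h
    refine ⟨fun i hi d hd => ?_, fun htn => ?_⟩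
    · exact van_quot_of_ideal I i d (van_bot_lt i (by omega) d) (h (i + 1) (by omega) d hd)
    · by_contra hcon
      exact not_van_top hI hne (h n (by omega) (-(n : ℤ)) (by omega))
  · rintro ⟨h1, h2⟩ i hi d hd
    have hS : van (⊤ : Ideal (MvPolynomial (Fin n) k)) ⊥ i d := by
      rcases lt_or_eq_of_le (show i ≤ n by omega) with h | h
      · exact van_bot_lt i h d
      · subst h
        have := h2 (by omega)
        exact van_bot_top d (by omega)
    cases i with
    | zero => exact van_ideal_zero I d hS
    | succ i => exact van_ideal_of_quot I i d hS (h1 i (by omega) d hd)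

theorem WW_iff_Cinj {I : Ideal (MvPolynomial (Fin n) k)} (hI : IsHomog I) (hne : I ≠ ⊥)
    (hfr : FRI I) (t : ℕ) (ht : t ≤ n) (b : ℕ → ℤ) (hb : ∀ i, b i ≤ b (i + 1) + 1) :
    WW I (t + 1) b ↔ (∀ (l : ℕ) (h : l < n), l < t → Cinj (JJ I l) (zz h) (b (l + 1) + l)) ∧
      (t = n → -(n : ℤ) ≤ b n) := by
  rw [WW_iff hI hne t ht]
  refine and_congr_left fun _ => ?_
  have := VV_iter hI hfr t ht 0 (fun i => b (i + 1)) (fun i => hb (i + 1))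
  rw [add_zero] at this
  rw [this]
  refine and_iff_left fun i hi => absurd hi (by omega)


/-! ### Initial ideals for the reverse lexicographic order -/

theorem adeg_eq (a : Fin n →₀ ℕ) : adeg a = a.degree := by
  rw [Finsupp.degree_eq_sum]; rfl

theorem colex_lt_iff (a b : Fin n →₀ ℕ) :
    toColex (⇑b) < toColex (⇑a) ↔ ∃ i : Fin n, b i < a i ∧ ∀ j : Fin n, i < j → a j = b j := by
  constructor
  · rintro ⟨i, h1, h2⟩
    exact ⟨i, h2, fun j hj => (h1 j hj).symm⟩
  · rintro ⟨i, h1, h2⟩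
    exact ⟨i, fun j hj => (h2 j hj).symm, h1⟩

theorem drlt_iff_of_deg {a b : Fin n →₀ ℕ} (h : a.degree = b.degree) :
    drlt a b ↔ toColex (⇑b) < toColex (⇑a) := by
  rw [colex_lt_iff]
  unfold drlt
  rw [adeg_eq, adeg_eq, h]
  simp

theorem drlt_add_iff (c a b : Fin n →₀ ℕ) : drlt (c + a) (c + b) ↔ drlt a b := by
  unfold drlt
  simp only [adeg_eq, map_add, Finsupp.add_apply]
  simp

/-- `a` is a leading exponent of an element of `I`. -/
def LeadE (I : Ideal (MvPolynomial (Fin n) k)) (a : Fin n →₀ ℕ) : Prop :=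
  ∃ f ∈ I, IsLeadExp drlt f a

theorem exists_lead {d : ℤ} {f : MvPolynomial (Fin n) k} (hf : f ∈ sPiece k n d) (h0 : f ≠ 0) :
    ∃ a, IsLeadExp drlt f a := by
  obtain ⟨a, ha, hmin⟩ := Finset.exists_min_image f.support (fun a => toColex (⇑a))
    (Finset.nonempty_iff_ne_empty.mpr (mt support_eq_empty.mp h0))
  refine ⟨a, ha, fun b hb hne => ?_⟩
  have h1 := mem_sPiece.mp hf a ha
  have h2 := mem_sPiece.mp hf b hb
  rw [drlt_iff_of_deg (by omega)]
  refine lt_of_le_of_ne (hmin b hb) fun h => hne ?_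
  exact (DFunLike.coe_injective (toColex.injective h)).symm

theorem LeadE_up {I : Ideal (MvPolynomial (Fin n) k)} {a m : Fin n →₀ ℕ} (h : LeadE I a) (ham : a ≤ m) :
    LeadE I m := by
  classical
  obtain ⟨f, hf, hlead⟩ := h
  have hm : m - a + a = m := tsub_add_cancel_of_le ham
  refine ⟨monomial (m - a) 1 * f, Ideal.mul_mem_left _ _ hf, ?_, ?_⟩
  · rw [MvPolynomial.mem_support_iff]
    have e := coeff_monomial_mul a (m - a) (1 : k) f
    rw [hm, one_mul] at e
    rw [e]
    exact MvPolynomial.mem_support_iff.mp hlead.1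
  · intro b hb hne
    rw [MvPolynomial.mem_support_iff, coeff_monomial_mul'] at hb
    split_ifs at hb with hle
    · rw [one_mul] at hb
      have hb' : m - a + (b - (m - a)) = b := add_tsub_cancel_of_le hle
      have := hlead.2 (b - (m - a)) (MvPolynomial.mem_support_iff.mpr hb) (by
        intro h
        rw [h, hm] at hb'
        exact hne hb'.symm)
      rw [← drlt_add_iff (m - a), hb', hm] at this
      exact this
    · exact absurd rfl hb

theorem inIdeal_eq (I : Ideal (MvPolynomial (Fin n) k)) :
    inIdeal I = Ideal.span ((fun a => monomial a (1 : k)) '' {a | LeadE I a}) := by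
  unfold inIdeal inIdealW
  congr 1
  ext m
  constructor
  · rintro ⟨f, a, hf, hl, rfl⟩
    exact ⟨a, ⟨f, hf, hl⟩, rfl⟩
  · rintro ⟨a, ⟨f, hf, hl⟩, rfl⟩
    exact ⟨f, a, hf, hl, rfl⟩

theorem mem_inIdeal {I : Ideal (MvPolynomial (Fin n) k)} {x : MvPolynomial (Fin n) k} :
    x ∈ inIdeal I ↔ ∀ m ∈ x.support, LeadE I m := by
  rw [inIdeal_eq, mem_ideal_span_monomial_image]
  constructor
  · intro h m hm
    obtain ⟨a, ha, ham⟩ := h m hm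
    exact LeadE_up ha ham
  · intro h m hm
    exact ⟨m, h m hm, le_rfl⟩

theorem inIdeal_homog (I : Ideal (MvPolynomial (Fin n) k)) : IsHomog (inIdeal I) := by
  intro f hf d
  rw [mem_inIdeal] at *
  intro m hm
  apply hf
  rw [MvPolynomial.mem_support_iff, coeff_homogeneousComponent] at hm
  rw [MvPolynomial.mem_support_iff]
  intro h
  simp [h] at hm

theorem LeadE_homog {I : Ideal (MvPolynomial (Fin n) k)} (hI : IsHomog I) {a : Fin n →₀ ℕ}
    (h : LeadE I a) : ∃ f ∈ I, f ∈ sPiece k n a.degree ∧ IsLeadExp drlt f a := by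
  obtain ⟨f, hf, hl⟩ := h
  refine ⟨homogeneousComponent a.degree f, hI f hf _, sP_comp _ _, ?_, ?_⟩
  · rw [MvPolynomial.mem_support_iff, coeff_homogeneousComponent, if_pos rfl]
    exact MvPolynomial.mem_support_iff.mp hl.1
  · intro b hb hne
    apply hl.2 b _ hne
    rw [MvPolynomial.mem_support_iff, coeff_homogeneousComponent] at hb
    rw [MvPolynomial.mem_support_iff]
    intro h
    simp [h] at hb

theorem LeadE_of_X_mem {I : Ideal (MvPolynomial (Fin n) k)} {j : Fin n} (hj : X j ∈ I)
    {m : Fin n →₀ ℕ} (hm : m j ≠ 0) : LeadE I m := by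
  classical
  have h1 : LeadE I (Finsupp.single j 1) := by
    refine ⟨X j, hj, ?_, ?_⟩
    · simp [support_X]
    · intro b hb hne
      rw [support_X, Finset.mem_singleton] at hb
      exact absurd hb hne
  refine LeadE_up h1 ?_
  rw [Finsupp.single_le_iff]
  omega

theorem Cinj_of_in {J : Ideal (MvPolynomial (Fin n) k)} (hJ : IsHomog J) (z : Fin n) (c : ℤ)
    (h : Cinj (inIdeal J) z c) : Cinj J z c := by
  classical
  intro d hd f0 hf0 hzf0
  by_contra hcon
  let B : Set (Fin n →₀ ℕ) := {a | ∃ f ∈ sPiece k n d, X z * f ∈ J ∧ f ∉ J ∧ IsLeadExp drlt f a}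
  have hBne : B.Nonempty := by
    obtain ⟨a, ha⟩ := exists_lead hf0 (fun h => hcon (h ▸ Submodule.zero_mem _))
    exact ⟨a, f0, hf0, hzf0, hcon, ha⟩
  have hBfin : B.Finite := by
    refine (Finsupp.finite_of_degree_eq (σ := Fin n) d.toNat).subset ?_
    rintro a ⟨f, hf, _, _, hl⟩
    have := mem_sPiece.mp hf a hl.1
    show a.degree = d.toNat
    omega
  obtain ⟨a, ⟨f, hf, hzf, hfJ, hl⟩, hmax⟩ := Set.exists_max_image B (fun a => toColex (⇑a)) hBfin hBne
  have hda := mem_sPiece.mp hf a hl.1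
  -- the leading exponent of `z f`
  have h1 : LeadE J (Finsupp.single z 1 + a) := by
    refine ⟨X z * f, hzf, ?_, ?_⟩
    · rw [MvPolynomial.mem_support_iff, coeff_X_mul]
      exact MvPolynomial.mem_support_iff.mp hl.1
    · intro b hb hne
      rw [support_X_mul, Finset.mem_map] at hb
      obtain ⟨b', hb', rfl⟩ := hb
      simp only [addLeftEmbedding_apply] at hne ⊢
      rw [drlt_add_iff]
      exact hl.2 b' hb' (fun h => hne (by rw [h]))
  have h2 : monomial a (1 : k) ∈ inIdeal J := by
    refine h d hd _ ?_ ?_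
    · rw [mem_sPiece]
      intro b hb
      have := support_monomial_subset hb
      rw [Finset.mem_singleton] at this
      rw [this, hda]
    · rw [mem_inIdeal]
      intro b hb
      rw [support_X_mul, Finset.mem_map] at hb
      obtain ⟨b', hb', rfl⟩ := hb
      have := support_monomial_subset hb'
      rw [Finset.mem_singleton] at this
      rw [this]
      exact h1
  obtain ⟨g, hg, hgd, hgl⟩ := LeadE_homog hJ (mem_inIdeal.mp h2 a (by simp [support_monomial]))
  rw [hda] at hgd
  have hga := MvPolynomial.mem_support_iff.mp hgl.1
  set q := coeff a f / coeff a g with hq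
  have hCg : C q * g ∈ sPiece k n d := by
    rw [← MvPolynomial.smul_eq_C_mul]
    exact Submodule.smul_mem _ _ hgd
  have hf' : f - C q * g ∈ sPiece k n d := Submodule.sub_mem _ hf hCg
  have hf'J : f - C q * g ∉ J := fun h =>
    hfJ (by simpa using Submodule.add_mem _ h (Ideal.mul_mem_left J (C q) hg))
  obtain ⟨b, hb⟩ := exists_lead hf' (fun h => hf'J (h ▸ Submodule.zero_mem _))
  have hbB : b ∈ B := by
    refine ⟨_, hf', ?_, hf'J, hb⟩
    rw [mul_sub]
    exact Submodule.sub_mem _ hzf (Ideal.mul_mem_left _ _ (Ideal.mul_mem_left _ _ hg))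
  have hbc := MvPolynomial.mem_support_iff.mp hb.1
  rw [coeff_sub, coeff_C_mul] at hbc
  have hba : b ≠ a := by
    rintro rfl
    apply hbc
    rw [hq]
    field_simp
    ring
  have hlt : drlt b a := by
    by_cases hbf : coeff b f = 0
    · apply hgl.2 b _ hba
      rw [MvPolynomial.mem_support_iff]
      intro h
      rw [hbf, h] at hbc
      simp at hbc
    · exact hl.2 b (MvPolynomial.mem_support_iff.mpr hbf) hba
  have hdb := mem_sPiece.mp hf' b hb.1
  rw [drlt_iff_of_deg (by omega)] at hlt
  exact absurd (hmax b hbB) (not_le.mpr hlt)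

theorem Cinj_in {J : Ideal (MvPolynomial (Fin n) k)} (hJ : IsHomog J) (z : Fin n) (c : ℤ)
    (hz : ∀ j, z < j → X j ∈ J) (h : Cinj J z c) : Cinj (inIdeal J) z c := by
  classical
  intro d hd f hf hzf
  rw [mem_inIdeal] at *
  intro m hm
  by_cases hlater : ∃ j, z < j ∧ m j ≠ 0
  · obtain ⟨j, hj, hmj⟩ := hlater
    exact LeadE_of_X_mem (hz j hj) hmj
  push Not at hlater
  have hdm := mem_sPiece.mp hf m hm
  obtain ⟨g, hg, hgd, hgl⟩ := LeadE_homog hJ (hzf (Finsupp.single z 1 + m) (by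
    rw [MvPolynomial.mem_support_iff, coeff_X_mul]
    exact MvPolynomial.mem_support_iff.mp hm))
  have hdec := divMonomial_add_modMonomial g (Finsupp.single z 1)
  set q := g.divMonomial (Finsupp.single z 1) with hq
  set r := g.modMonomial (Finsupp.single z 1) with hr
  have hr' : r ∈ Ideal.span (X '' {j : Fin n | z < j} : Set (MvPolynomial (Fin n) k)) := by
    rw [mem_ideal_span_X_image]
    intro b hb
    rw [MvPolynomial.mem_support_iff] at hb
    have hbz : b z = 0 := by
      by_contra hbz
      apply hb
      rw [hr]
      apply coeff_modMonomial_of_le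
      rw [Finsupp.single_le_iff]
      omega
    have hbg : b ∈ g.support := by
      rw [hr, coeff_modMonomial_of_not_le] at hb
      · exact MvPolynomial.mem_support_iff.mpr hb
      · rw [Finsupp.single_le_iff]
        omega
    have hne : b ≠ Finsupp.single z 1 + m := by
      rintro rfl
      simp at hbz
    have h1 := hgl.2 b hbg hne
    have hdeg : b.degree = (Finsupp.single z 1 + m).degree := by
      have := mem_sPiece.mp hgd b hbg
      exact_mod_cast this
    rw [drlt_iff_of_deg hdeg, colex_lt_iff] at h1
    obtain ⟨i, hi, hi'⟩ := h1
    refine ⟨i, ?_, by omega⟩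
    show z < i
    rcases lt_trichotomy i z with h | h | h
    · have := hi' z h
      rw [hbz] at this
      simp at this
      omega
    · subst h
      omega
    · exact h
  have hrJ : r ∈ J := by
    refine (Ideal.span_le.mpr ?_) hr'
    rintro _ ⟨j, hj, rfl⟩
    exact hz j hj
  have hqc : ∀ b, coeff b q = coeff (Finsupp.single z 1 + b) g := fun b => by
    rw [hq, coeff_divMonomial]
  have hqd : q ∈ sPiece k n d := by
    rw [mem_sPiece]
    intro b hb
    rw [MvPolynomial.mem_support_iff, hqc] at hb
    have := mem_sPiece.mp hgd _ (MvPolynomial.mem_support_iff.mpr hb)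
    simp only [map_add] at this
    push_cast at this
    omega
  have hqJ : q ∈ J := by
    refine h d hd q hqd ?_
    have : X z * q = g - r := by
      rw [← hdec]
      simp only [X]
      ring
    rw [this]
    exact Submodule.sub_mem _ hg hrJ
  refine ⟨q, hqJ, ?_, ?_⟩
  · rw [MvPolynomial.mem_support_iff, hqc]
    exact MvPolynomial.mem_support_iff.mp hgl.1
  · intro b hb hne
    rw [MvPolynomial.mem_support_iff, hqc] at hb
    rw [← drlt_add_iff (Finsupp.single z 1)]
    exact hgl.2 _ (MvPolynomial.mem_support_iff.mpr hb) (fun h => hne (add_left_cancel h))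

theorem JJ_inIdeal {I : Ideal (MvPolynomial (Fin n) k)} (hI : IsHomog I) (m : ℕ) (hm : m ≤ n) :
    JJ (inIdeal I) m = inIdeal (JJ I m) := by
  classical
  apply le_antisymm
  · refine sup_le ?_ ?_
    · intro x hx
      rw [mem_inIdeal] at *
      intro a ha
      obtain ⟨f, hf, hl⟩ := hx a ha
      exact ⟨f, Ideal.mem_sup_left hf, hl⟩
    · rw [Ideal.span_le]
      rintro _ ⟨j, hj, rfl⟩
      show X j ∈ inIdeal (JJ I m)
      rw [mem_inIdeal]
      intro a ha
      rw [support_X, Finset.mem_singleton] at ha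
      subst ha
      have hXj : X j ∈ JJ I m := Ideal.mem_sup_right (Ideal.subset_span ⟨j, hj, rfl⟩)
      exact LeadE_of_X_mem hXj (by simp)
  · rw [inIdeal_eq, Ideal.span_le]
    rintro _ ⟨a, ha, rfl⟩
    show monomial a (1 : k) ∈ JJ (inIdeal I) m
    by_cases hZ : ∃ j : Fin n, n ≤ (j : ℕ) + m ∧ a j ≠ 0
    · obtain ⟨j, hj, haj⟩ := hZ
      apply Ideal.mem_sup_right
      rw [mem_ideal_span_X_image]
      intro b hb
      have := support_monomial_subset hb
      rw [Finset.mem_singleton] at this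
      subst this
      exact ⟨j, hj, haj⟩
    push Not at hZ
    obtain ⟨f, hf, hfd, hfl⟩ := LeadE_homog (JJ_homog hI m hm) ha
    obtain ⟨g, hg, h, hh, hgh⟩ := Submodule.mem_sup.mp hf
    have hcoeff : ∀ b : Fin n →₀ ℕ, b.degree = a.degree → (∀ j : Fin n, n ≤ (j : ℕ) + m → b j = 0) →
        coeff b (homogeneousComponent a.degree g) = coeff b f := by
      intro b hb hbZ
      rw [coeff_homogeneousComponent, if_pos hb, ← hgh, coeff_add]
      have : coeff b h = 0 := by
        by_contra hne
        obtain ⟨i, hi, hi'⟩ := mem_ideal_span_X_image.mp hh b (MvPolynomial.mem_support_iff.mpr hne)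
        exact hi' (hbZ i hi)
      rw [this, add_zero]
    apply Ideal.mem_sup_left
    rw [mem_inIdeal]
    intro a' ha'
    have := support_monomial_subset ha'
    rw [Finset.mem_singleton] at this
    subst this
    refine ⟨homogeneousComponent a'.degree g, hI g hg _, ?_, ?_⟩
    · rw [MvPolynomial.mem_support_iff, hcoeff a' rfl hZ]
      exact MvPolynomial.mem_support_iff.mp hfl.1
    · intro b hb hne
      have hdeg : b.degree = a'.degree := by
        exact_mod_cast mem_sPiece.mp (sP_comp g a'.degree) b hb
      by_cases hbZ : ∀ j : Fin n, n ≤ (j : ℕ) + m → b j = 0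
      · apply hfl.2 b _ hne
        rw [MvPolynomial.mem_support_iff, ← hcoeff b hdeg hbZ]
        exact MvPolynomial.mem_support_iff.mp hb
      · push Not at hbZ
        obtain ⟨j0, hj0, hbj0⟩ := hbZ
        rw [drlt_iff_of_deg hdeg]
        rcases lt_trichotomy (toColex (⇑a')) (toColex (⇑b)) with h1 | h1 | h1
        · exact h1
        · exact absurd (DFunLike.coe_injective (toColex.injective h1)).symm hne
        · exfalso
          obtain ⟨i, hi, hi'⟩ := (colex_lt_iff _ _).mp h1
          have hiZ : ¬ n ≤ (i : ℕ) + m := fun hcon => by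
            have := hZ i hcon
            omega
          have := hi' j0 (by rw [Fin.lt_def]; omega)
          rw [hZ j0 hj0] at this
          exact hbj0 this.symm

theorem Cinj_JJ_iff {I : Ideal (MvPolynomial (Fin n) k)} (hI : IsHomog I) (l : ℕ) (h : l < n)
    (c : ℤ) : Cinj (JJ I l) (zz h) c ↔ Cinj (JJ (inIdeal I) l) (zz h) c := by
  rw [JJ_inIdeal hI l h.le]
  constructor
  · refine Cinj_in (JJ_homog hI l h.le) _ _ fun j hj => ?_
    refine Ideal.mem_sup_right (Ideal.subset_span ⟨j, ?_, rfl⟩)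
    rw [Fin.lt_def] at hj
    simp only [zz] at hj
    show n ≤ (j : ℕ) + l
    omega
  · exact Cinj_of_in (JJ_homog hI l h.le) _ _

theorem inIdeal_bot : inIdeal (⊥ : Ideal (MvPolynomial (Fin n) k)) = ⊥ := by
  rw [eq_bot_iff]
  intro x hx
  rw [mem_inIdeal] at hx
  rw [Submodule.mem_bot]
  by_contra h0
  obtain ⟨m, hm⟩ := Finset.nonempty_iff_ne_empty.mpr (mt support_eq_empty.mp h0)
  obtain ⟨f, hf, hl⟩ := hx m hm
  rw [(Submodule.mem_bot _).mp hf] at hl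
  simpa using hl.1

theorem inIdeal_ne_bot {I : Ideal (MvPolynomial (Fin n) k)} (hI : IsHomog I) (h : I ≠ ⊥) :
    inIdeal I ≠ ⊥ := by
  obtain ⟨g, hg, hg0⟩ := Submodule.exists_mem_ne_zero_of_ne_bot h
  obtain ⟨m0, hm0⟩ := Finset.nonempty_iff_ne_empty.mpr (mt support_eq_empty.mp hg0)
  have h1 : homogeneousComponent m0.degree g ≠ 0 := by
    intro h0
    have := congrArg (coeff m0) h0
    rw [coeff_homogeneousComponent, if_pos rfl] at this
    exact MvPolynomial.mem_support_iff.mp hm0 this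
  obtain ⟨a, ha⟩ := exists_lead (sP_comp g m0.degree) h1
  intro hbot
  have h2 : monomial a (1 : k) ∈ inIdeal I := by
    rw [inIdeal_eq]
    exact Ideal.subset_span ⟨a, ⟨_, hI g hg _, ha⟩, rfl⟩
  rw [hbot, Submodule.mem_bot, monomial_eq_zero] at h2
  exact one_ne_zero h2


/-! ### Filter regularity -/

theorem fr_ring {R : Type*} [CommRing R] [IsNoetherianRing R] (a m : Ideal R) (z : R)
    (h : ∀ p ∈ associatedPrimes R (R ⧸ a), p ≠ m → z ∉ p) :
    ∃ K : ℕ, ∀ y, z * y ∈ a → ∀ u ∈ m ^ K, u * y ∈ a := by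
  let N : Submodule R (R ⧸ a) := LinearMap.ker (LinearMap.lsmul R (R ⧸ a) z)
  have hzN : z ∈ Module.annihilator R N := by
    rw [Module.mem_annihilator]
    rintro ⟨y, hy⟩
    exact Subtype.ext hy
  have h1 : m ≤ (Module.annihilator R N).radical := by
    rw [← Ideal.sInf_minimalPrimes]
    refine le_sInf fun p hp => ?_
    have hpN := Module.associatedPrimes.minimalPrimes_annihilator_subset_associatedPrimes R N hp
    have hpM : p ∈ associatedPrimes R (R ⧸ a) :=
      associatedPrimes.subset_of_injective (f := N.subtype) N.subtype_injective hpN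
    by_contra hne
    exact h p hpM (fun e => hne e.ge) (hp.1.2 hzN)
  obtain ⟨K, hK⟩ := Ideal.exists_pow_le_of_le_radical_of_fg h1 (IsNoetherian.noetherian m)
  refine ⟨K, fun y hy u hu => ?_⟩
  have h2 := Module.mem_annihilator.mp (hK hu) ⟨Ideal.Quotient.mk a y, by
    show z • Ideal.Quotient.mk a y = 0
    rw [← Ideal.Quotient.mk_eq_mk, ← Submodule.Quotient.mk_smul, Submodule.Quotient.mk_eq_zero]
    exact hy⟩
  have h3 := congrArg Subtype.val h2
  change u • Ideal.Quotient.mk a y = 0 at h3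
  rw [← Ideal.Quotient.mk_eq_mk, ← Submodule.Quotient.mk_smul, Submodule.Quotient.mk_eq_zero] at h3
  exact h3

theorem maxIdeal_eq : maxIdeal k n = idealOfVars (Fin n) k := rfl

theorem Cinj_of_pow {J : Ideal (MvPolynomial (Fin n) k)} (hJ : IsHomog J) (z : Fin n) (K : ℕ)
    (h : ∀ f, X z * f ∈ J → ∀ u ∈ maxIdeal k n ^ K, u * f ∈ J) : ∃ c, Cinj J z c := by
  classical
  let Q : Ideal (MvPolynomial (Fin n) k) := Submodule.comap (LinearMap.mulLeft _ (X z)) J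
  have hQ : ∀ f, f ∈ Q ↔ X z * f ∈ J := fun f => Iff.rfl
  obtain ⟨G, hG⟩ := IsNoetherian.noetherian Q
  set D := G.sup totalDegree with hD
  have key : ∀ f ∈ Q, ∀ (d : ℕ) (a : MvPolynomial (Fin n) k), D + K ≤ d →
      homogeneousComponent d (a * f) ∈ J := by
    intro f hf
    rw [← hG] at hf
    induction hf using Submodule.span_induction with
    | mem g hg =>
      intro d a hd
      have hgQ : X z * g ∈ J := by
        rw [← hQ, ← hG]
        exact Submodule.subset_span hg
      have hgD : g.totalDegree ≤ D := Finset.le_sup (f := totalDegree) hg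
      set low := ∑ e ∈ Finset.range K, homogeneousComponent e a with hlow
      have hrest : a - low ∈ maxIdeal k n ^ K := by
        rw [maxIdeal_eq, mem_pow_idealOfVars_iff']
        intro x hx
        rw [coeff_sub, hlow, coeff_sum]
        simp only [coeff_homogeneousComponent]
        rw [Finset.sum_ite_eq, if_pos (Finset.mem_range.mpr hx), sub_self]
      have hlow0 : homogeneousComponent d (low * g) = 0 := by
        rw [hlow, Finset.sum_mul, map_sum]
        refine Finset.sum_eq_zero fun e he => homogeneousComponent_eq_zero _ _ ?_
        have h1 := totalDegree_mul (homogeneousComponent e a) g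
        have h2 : (homogeneousComponent e a).totalDegree ≤ e :=
          (homogeneousComponent_isHomogeneous e a).totalDegree_le
        have := Finset.mem_range.mp he
        omega
      have : a * g = low * g + (a - low) * g := by ring
      rw [this, map_add, hlow0, zero_add]
      exact hJ _ (h g hgQ _ hrest) d
    | zero => intro d a _; simp
    | add x y _ _ hx hy =>
      intro d a hd
      rw [mul_add, map_add]
      exact J.add_mem (hx d a hd) (hy d a hd)
    | smul b x _ hx =>
      intro d a hd
      rw [smul_eq_mul, ← mul_assoc]
      exact hx d _ hd
  refine ⟨(D + K : ℕ), fun d hd f hf hzf => ?_⟩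
  have h0 := key f hzf d.toNat 1 (by omega)
  rwa [one_mul, sP_comp_eq (sP_congr hf (by omega))] at h0

theorem FRI_of_hfr {I : Ideal (MvPolynomial (Fin n) k)} (hI : IsHomog I)
    (hfr : FilterRegular (maxIdealQ I) (revVars I) n) : FRI I := by
  intro l hl
  obtain ⟨K, hK⟩ := fr_ring _ _ _ (hfr l hl)
  set a := Ideal.span {x | ∃ j < l, x = revVars I j} with ha
  have hz : revVars I l = Ideal.Quotient.mk I (X (zz hl)) := by
    unfold revVars
    rw [dif_pos hl]
    rfl
  have hmap : (JJ I l).map (Ideal.Quotient.mk I) = a := by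
    unfold JJ
    rw [Ideal.map_sup, Ideal.map_quotient_self, bot_sup_eq, Ideal.map_span, ha]
    congr 1
    ext x
    constructor
    · rintro ⟨_, ⟨j, hj, rfl⟩, rfl⟩
      have hj' : n ≤ (j : ℕ) + l := hj
      have hjn := j.2
      refine ⟨n - 1 - j, by omega, ?_⟩
      unfold revVars
      rw [dif_pos (by omega)]
      congr 2
      ext
      simp only
      omega
    · rintro ⟨j, hj, rfl⟩
      refine ⟨X ⟨n - 1 - j, by omega⟩, ⟨_, ?_, rfl⟩, ?_⟩
      · show n ≤ n - 1 - j + l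
        omega
      · unfold revVars
        rw [dif_pos (by omega)]
  have hmem : ∀ f, f ∈ JJ I l ↔ Ideal.Quotient.mk I f ∈ a := by
    intro f
    rw [← hmap, ← Ideal.mem_comap, Ideal.comap_map_of_surjective _ Ideal.Quotient.mk_surjective,
      ← RingHom.ker_eq_comap_bot, Ideal.mk_ker]
    rw [sup_eq_left.mpr]
    exact le_sup_left
  refine Cinj_of_pow (JJ_homog hI l hl.le) _ K fun f hf u hu => ?_
  rw [hmem, map_mul] at hf ⊢
  rw [← hz] at hf
  refine hK _ hf _ ?_
  unfold maxIdealQ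
  rw [← Ideal.map_pow]
  exact Ideal.mem_map_of_mem _ hu

/-! ### Translation to the definition of local cohomology -/

/-- extension of a cochain by zero to a total cochain -/
def ev {I : Ideal (MvPolynomial (Fin n) k)} {i : ℕ} (v : Koch n ↥I i) (T : Finset (Fin n)) :
    MvPolynomial (Fin n) k :=
  if h : T.card = i then (v ⟨T, h⟩ : MvPolynomial (Fin n) k) else 0

theorem ev_of {I : Ideal (MvPolynomial (Fin n) k)} {i : ℕ} (v : Koch n ↥I i) {T : Finset (Fin n)}
    (h : T.card = i) : ev v T = (v ⟨T, h⟩ : MvPolynomial (Fin n) k) := dif_pos h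

theorem KD_congr (t i : ℕ) {v w : Finset (Fin n) → MvPolynomial (Fin n) k}
    (h : ∀ T, T.card = i → v T = w T) {T : Finset (Fin n)} (hT : T.card - 1 = i) :
    KD t v T = KD t w T := by
  unfold KD
  refine Finset.sum_congr rfl fun j hj => ?_
  rw [h]
  rw [Finset.card_erase_of_mem hj, hT]

theorem kdelta_val {I : Ideal (MvPolynomial (Fin n) k)} (t i : ℕ) (v : Koch n ↥I (i - 1))
    (T : {T : Finset (Fin n) // T.card = i}) :
    ((kdelta (k := k) t i v T : ↥I) : MvPolynomial (Fin n) k) = KD t (ev v) T.1 := by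
  unfold kdelta KD
  rw [← Finset.sum_attach T.1]
  rw [AddSubmonoidClass.coe_finsetSum]
  refine Finset.sum_congr rfl fun j _ => ?_
  have hc : (T.1.erase j.1).card = i - 1 := by rw [Finset.card_erase_of_mem j.2, T.2]
  rw [ev_of v hc]
  unfold sg
  push_cast
  simp [zsmul_eq_mul]

theorem ktrans_val {I : Ideal (MvPolynomial (Fin n) k)} (i s : ℕ) (v : Koch n ↥I i)
    (T : {T : Finset (Fin n) // T.card = i}) :
    (((ktrans (k := k) i)^[s] v) T : MvPolynomial (Fin n) k) = KT s (ev v) T.1 := by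
  induction s with
  | zero => simp [KT, ev_of v T.2]
  | succ s ih =>
    rw [Function.iterate_succ_apply']
    unfold ktrans
    unfold ktrans at ih
    rw [Submodule.coe_smul, ih]
    unfold KT
    rw [smul_eq_mul]
    ring

theorem van_of_not {I : Ideal (MvPolynomial (Fin n) k)} {i : ℕ} {d : ℤ}
    (h : ¬ lcNonvanish n (iPiece I) i d) : van I ⊥ i d := by
  intro t v hvI hvd hvz
  by_contra hcon
  apply h
  let v' : Koch n ↥I i := fun T => ⟨v T.1, hvI T.1 T.2⟩
  have hv' : ∀ T, T.card = i → ev v' T = v T := fun T hT => ev_of v' hT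
  refine ⟨t, v', fun T => hvd T.1 T.2, ?_, ?_⟩
  · funext T
    apply Subtype.ext
    rw [kdelta_val, KD_congr t i hv' (by rw [T.2]; rfl)]
    exact hvz T.1 T.2
  · rintro s ⟨w, hw, hww⟩
    apply hcon
    refine ⟨s, ev w, ?_, ?_⟩
    · rintro i' rfl T hT
      rw [ev_of w hT]
      exact ⟨(w ⟨T, hT⟩).2, hw ⟨T, hT⟩⟩
    · intro T hT
      have h1 := congrArg (fun u : Koch n ↥I i => (u ⟨T, hT⟩ : MvPolynomial (Fin n) k)) hww
      try simp only at h1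
      rw [kdelta_val, ktrans_val] at h1
      rw [h1]
      simp only [KT]
      rw [hv' T hT, sub_self]
      exact Submodule.zero_mem _

theorem not_of_van {I : Ideal (MvPolynomial (Fin n) k)} {i : ℕ} {d : ℤ}
    (h : van I ⊥ i d) : ¬ lcNonvanish n (iPiece I) i d := by
  rintro ⟨t, v, hv, hvz, hno⟩
  obtain ⟨s, w, hw, hww⟩ := h t (ev v)
    (fun T hT => by rw [ev_of v hT]; exact (v ⟨T, hT⟩).2)
    (fun T hT => by rw [ev_of v hT]; exact hv ⟨T, hT⟩)
    (fun T hT => by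
      have h1 := congrArg (fun u : Koch n ↥I (i + 1) => (u ⟨T, hT⟩ : MvPolynomial (Fin n) k)) hvz
      try simp only at h1
      rw [kdelta_val] at h1
      rw [Submodule.mem_bot]
      exact h1)
  apply hno s
  cases i with
  | zero =>
    refine ⟨0, fun T => Submodule.zero_mem _, ?_⟩
    funext T
    apply Subtype.ext
    have h2 := (Submodule.mem_bot _).mp (hww T.1 T.2)
    rw [kdelta_val, ktrans_val, sub_eq_zero.mp h2]
    have h3 : T.1 = ∅ := Finset.card_eq_zero.mp T.2
    unfold KD
    rw [h3]
    rfl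
  | succ i =>
    let w' : Koch n ↥I (i + 1 - 1) := fun T => ⟨w T.1, (hw i rfl T.1 T.2).1⟩
    have hw' : ∀ T, T.card = i → ev w' T = w T := fun T hT => ev_of w' hT
    refine ⟨w', fun T => (hw i rfl T.1 T.2).2, ?_⟩
    funext T
    apply Subtype.ext
    have h2 := (Submodule.mem_bot _).mp (hww T.1 T.2)
    rw [kdelta_val, ktrans_val, sub_eq_zero.mp h2, KD_congr (t + s) i hw' (by rw [T.2]; rfl)]

theorem lc_iff {I : Ideal (MvPolynomial (Fin n) k)} {i : ℕ} {d : ℤ} :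
    lcNonvanish n (iPiece I) i d ↔ ¬ van I ⊥ i d :=
  ⟨fun h hv => not_of_van hv h, fun h => by_contra fun hc => h (van_of_not hc)⟩

/-! ### Conclusion -/

theorem bound_exists {I : Ideal (MvPolynomial (Fin n) k)} (hI : IsHomog I) (hne : I ≠ ⊥)
    (hfr : FRI I) (t : ℕ) (ht : t ≤ n) : ∃ r : ℤ, WW I (t + 1) (fun _ => r) := by
  choose c hc using hfr
  obtain ⟨r, hr⟩ := (Set.finite_range (fun l : Fin n => c l.1 l.2 - l.1)).bddAbove
  have hr' : ∀ l (h : l < n), c l h - l ≤ r := fun l h => hr ⟨⟨l, h⟩, rfl⟩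
  refine ⟨max r (-(n : ℤ)), ?_⟩
  rw [WW_iff_Cinj hI (by assumption) (fun l h => ⟨c l h, hc l h⟩) t ht _ (fun i => by omega)]
  refine ⟨fun l h _ d hd => hc l h d ?_, fun _ => le_max_right _ _⟩
  have := hr' l h
  have := le_max_left r (-(n : ℤ))
  omega

theorem aDeg_le_iff {I : Ideal (MvPolynomial (Fin n) k)} {i : ℕ}
    (hb : ∃ r : ℤ, ∀ d > r, van I ⊥ i d) (r : ℤ) :
    aDeg n (iPiece I) i ≤ (r : WithBot ℤ) ↔ ∀ d > r, van I ⊥ i d := by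
  obtain ⟨r0, hr0⟩ := hb
  have hbdd : BddAbove {d : ℤ | lcNonvanish n (iPiece I) i d} := by
    refine ⟨r0, fun d hd => ?_⟩
    by_contra hlt
    exact lc_iff.mp hd (hr0 d (not_le.mp hlt))
  unfold aDeg
  split_ifs with hex
  · rw [WithBot.coe_le_coe, csSup_le_iff hbdd hex]
    constructor
    · intro h d hd
      by_contra hv
      exact absurd (h d (lc_iff.mpr hv)) (not_le.mpr hd)
    · intro h d hd
      by_contra hlt
      exact lc_iff.mp hd (h d (not_le.mp hlt))
  · simp only [bot_le, true_iff]
    intro d _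
    by_contra hv
    exact hex ⟨d, lc_iff.mpr hv⟩

theorem wb_ext {x y : WithBot ℤ} (h : ∀ r : ℤ, x ≤ r ↔ y ≤ r) : x = y := by
  apply le_antisymm
  · induction y with
    | bot =>
      induction x with
      | bot => exact le_rfl
      | coe x =>
        have := (h (x - 1)).mpr bot_le
        rw [WithBot.coe_le_coe] at this
        omega
    | coe y => exact (h y).mpr le_rfl
  · induction x with
    | bot =>
      induction y with
      | bot => exact le_rfl
      | coe y =>
        have := (h (y - 1)).mp bot_le
        rw [WithBot.coe_le_coe] at this
        omega
    | coe x => exact (h x).mp le_rfl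

theorem add_le_iff (x : WithBot ℤ) (i r : ℤ) :
    x + (i : WithBot ℤ) ≤ (r : WithBot ℤ) ↔ x ≤ ((r - i : ℤ) : WithBot ℤ) := by
  induction x with
  | bot => simp
  | coe x =>
    rw [← WithBot.coe_add, WithBot.coe_le_coe, WithBot.coe_le_coe]
    omega

theorem regT_le_iff {I : Ideal (MvPolynomial (Fin n) k)} (hI : IsHomog I) (hne : I ≠ ⊥)
    (hfr : FRI I) (t : ℕ) (ht : t ≤ n) (r : ℤ) :
    regT n (iPiece I) t ≤ (r : WithBot ℤ) ↔ WW I (t + 1) (fun i => r - i) := by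
  obtain ⟨r0, hr0⟩ := bound_exists hI hne hfr t ht
  unfold regT
  rw [Finset.sup_le_iff]
  refine forall_congr' fun i => ?_
  rw [Finset.mem_range]
  refine imp_congr_right fun hi => ?_
  rw [add_le_iff, aDeg_le_iff ⟨r0, hr0 i hi⟩]

theorem aStarT_le_iff {I : Ideal (MvPolynomial (Fin n) k)} (hI : IsHomog I) (hne : I ≠ ⊥)
    (hfr : FRI I) (t : ℕ) (ht : t ≤ n) (r : ℤ) :
    aStarT n (iPiece I) t ≤ (r : WithBot ℤ) ↔ WW I (t + 1) (fun _ => r) := by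
  obtain ⟨r0, hr0⟩ := bound_exists hI hne hfr t ht
  unfold aStarT
  rw [Finset.sup_le_iff]
  refine forall_congr' fun i => ?_
  rw [Finset.mem_range]
  refine imp_congr_right fun hi => ?_
  rw [aDeg_le_iff ⟨r0, hr0 i hi⟩]

theorem WW_in_iff {I : Ideal (MvPolynomial (Fin n) k)} (hI : IsHomog I) (hne : I ≠ ⊥)
    (hfr : FRI I) (hfr' : FRI (inIdeal I)) (t : ℕ) (ht : t ≤ n) (b : ℕ → ℤ)
    (hb : ∀ i, b i ≤ b (i + 1) + 1) : WW I (t + 1) b ↔ WW (inIdeal I) (t + 1) b := by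
  rw [WW_iff_Cinj hI hne hfr t ht b hb,
    WW_iff_Cinj (inIdeal_homog I) (inIdeal_ne_bot hI hne) hfr' t ht b hb]
  refine and_congr_left' ?_
  refine forall_congr' fun l => forall_congr' fun h => imp_congr_right fun _ => ?_
  exact Cinj_JJ_iff hI l h _

theorem main_aux (I : Ideal (MvPolynomial (Fin n) k)) (hI : IsHomog I)
    (hfr : FilterRegular (maxIdealQ I) (revVars I) n)
    (t : ℕ) (ht : t ≤ n) :
    regT n (iPiece I) t = regT n (iPiece (inIdeal I)) t ∧
    aStarT n (iPiece I) t = aStarT n (iPiece (inIdeal I)) t := by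
  by_cases hne : I = ⊥
  · subst hne
    rw [inIdeal_bot]
    exact ⟨rfl, rfl⟩
  have h1 : FRI I := FRI_of_hfr hI hfr
  have h2 : FRI (inIdeal I) := fun l h =>
    (h1 l h).imp fun c hc => (Cinj_JJ_iff hI l h c).mp hc
  have hI' := inIdeal_homog I
  have hne' := inIdeal_ne_bot hI hne
  constructor
  · refine wb_ext fun r => ?_
    rw [regT_le_iff hI hne h1 t ht, regT_le_iff hI' hne' h2 t ht]
    exact WW_in_iff hI hne h1 h2 t ht _ fun i => by push_cast; omega
  · refine wb_ext fun r => ?_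
    rw [aStarT_le_iff hI hne h1 t ht, aStarT_le_iff hI' hne' h2 t ht]
    exact WW_in_iff hI hne h1 h2 t ht _ fun i => by omega

/-- Theorem 1.3: if `xₙ, …, x₁` is a filter-regular sequence in `S/I`, then for the
reverse lexicographic order, (i) `reg_t(I) = reg_t(in(I))` and (ii) `a*_t(I) = a*_t(in(I))`. -/
theorem statement3 {k : Type*} [Field k] {n : ℕ}
    (I : Ideal (MvPolynomial (Fin n) k)) (hI : IsHomog I)
    (hfr : FilterRegular (maxIdealQ I) (revVars I) n)
    (t : ℕ) (ht : t ≤ n) :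
    regT n (iPiece I) t = regT n (iPiece (inIdeal I)) t ∧
    aStarT n (iPiece I) t = aStarT n (iPiece (inIdeal I)) t := by
  exact main_aux I hI hfr t ht
end
end Paper
end

section
/- Assume char(k) = 0 and let I be a Borel-fixed monomial ideal of S = k[x_1,…,x_n]. For i = 1,…,n, if I has a minimal generator x^A with m(x^A) = i, then the largest integer r such that [(I, x_n,…,x_{i+1}) : x_i]_r ≠ (I, x_n,…,x_{i+1})_r equals max{deg(x^A) : x^A is a minimal generator of I with m(x^A) = i} − 1. -/
set_option synthInstance.maxHeartbeats 1000000
set_option maxHeartbeats 1000000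

/-! Common definitions: gradings, term orders, initial ideals, generic initial ideals,
Borel-fixed ideals, filter-regular sequences, a Koszul/Čech-type description of graded
local cohomology and the invariants `a_i`, `reg_t`, `a*_t`, minimal graded free
resolutions, and reductions. -/

namespace Paper

open MvPolynomial

noncomputable section

variable {k : Type*} [Field k] {n : ℕ}

lemma mem_mon (A : Set (Fin n →₀ ℕ)) (f : MvPolynomial (Fin n) k) :
    f ∈ Ideal.span ((fun a => (monomial a (1 : k))) '' A) ↔ ∀ c ∈ f.support, ∃ s ∈ A, s ≤ c :=
  mem_ideal_span_monomial_image

lemma mon_mem_mon (A : Set (Fin n →₀ ℕ)) (a : Fin n →₀ ℕ) :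
    (monomial a (1 : k)) ∈ Ideal.span ((fun a => (monomial a (1 : k))) '' A) ↔
      ∃ s ∈ A, s ≤ a := by
  classical
  rw [mem_mon, support_monomial, if_neg one_ne_zero]
  simp

lemma sup_eq_mon (A : Set (Fin n →₀ ℕ)) (i : ℕ) :
    Ideal.span ((fun a => (monomial a (1 : k))) '' A) ⊔
      Ideal.span {f | ∃ l : Fin n, i ≤ (l : ℕ) ∧ f = X l} =
    Ideal.span ((fun a => (monomial a (1 : k))) ''
      (A ∪ {c | ∃ l : Fin n, i ≤ (l : ℕ) ∧ c = Finsupp.single l 1})) := by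
  rw [Set.image_union, Ideal.span_union]
  congr 2
  ext f
  constructor
  · rintro ⟨l, hl, rfl⟩
    exact ⟨_, ⟨l, hl, rfl⟩, rfl⟩
  · rintro ⟨_, ⟨l, hl, rfl⟩, rfl⟩
    exact ⟨l, hl, rfl⟩

/-- Membership in `(I, x_n, ..., x_{i+1})`. -/
lemma mem_sup_mon (A : Set (Fin n →₀ ℕ)) (i : ℕ) (f : MvPolynomial (Fin n) k) :
    f ∈ Ideal.span ((fun a => (monomial a (1 : k))) '' A) ⊔
      Ideal.span {f | ∃ l : Fin n, i ≤ (l : ℕ) ∧ f = X l} ↔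
    ∀ c ∈ f.support, (∃ s ∈ A, s ≤ c) ∨ ∃ l : Fin n, i ≤ (l : ℕ) ∧ 0 < c l := by
  rw [sup_eq_mon, mem_mon]
  refine forall₂_congr fun c _ => ?_
  constructor
  · rintro ⟨s, hs | ⟨l, hl, rfl⟩, hsc⟩
    · exact Or.inl ⟨s, hs, hsc⟩
    · refine Or.inr ⟨l, hl, ?_⟩
      have := hsc l
      simp at this
      omega
  · rintro (⟨s, hs, hsc⟩ | ⟨l, hl, h⟩)
    · exact ⟨s, Or.inl hs, hsc⟩
    · exact ⟨_, Or.inr ⟨l, hl, rfl⟩, by simpa [Finsupp.single_le_iff, Nat.one_le_iff_ne_zero, Nat.pos_iff_ne_zero] using h⟩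

/-- Strong stability in characteristic zero. -/
lemma borel_step [CharZero k] (A : Set (Fin n →₀ ℕ))
    (hB : IsBorelFixed (Ideal.span ((fun a => (monomial a (1 : k))) '' A)))
    (b : Fin n →₀ ℕ) (j i : Fin n) (hji : j < i)
    (h : ∃ s ∈ A, s ≤ b + Finsupp.single i 1) :
    ∃ s ∈ A, s ≤ b + Finsupp.single j 1 := by
  set I := Ideal.span ((fun a => (monomial a (1 : k))) '' A) with hI
  let g : Matrix (Fin n) (Fin n) k := Matrix.transvection j i 1
  have hg : actI g I = I := by
    apply hB
    · simp [g, Matrix.det_transvection_of_ne _ _ hji.ne]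
    · intro p q hpq
      simp only [g, Matrix.transvection, Matrix.add_apply, Matrix.one_apply_ne hpq.ne', zero_add]
      rw [Matrix.single_apply]
      rw [if_neg]
      rintro ⟨rfl, rfl⟩
      exact absurd hpq (not_lt.mpr hji.le)
  have hmem : act g (monomial (b + Finsupp.single i 1) (1 : k)) ∈ I := by
    have := Ideal.mem_map_of_mem (act g) ((mon_mem_mon A _).2 h)
    rw [← hg]
    exact this
  have hX : ∀ l : Fin n, act g (X l) = if l = i then X i + X j else (X l : MvPolynomial (Fin n) k) := by
    intro l
    simp only [act, aeval_X, g, Matrix.transvection, Matrix.add_apply, Matrix.one_apply,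
      Matrix.single_apply, C_add, add_mul, Finset.sum_add_distrib]
    split_ifs with hl
    · subst hl
      simp [apply_ite C, ite_mul]
    · have : ¬ (i = l) := fun h => hl h.symm
      simp [apply_ite C, ite_mul, this]
  set m := b i with hm
  set b' := b.erase i with hb'
  have hb : b = b' + Finsupp.single i m := by
    rw [hb', hm, Finsupp.erase_add_single]
  have hact : act g (monomial (b + Finsupp.single i 1) (1 : k)) =
      monomial b' 1 * (X i + X j) ^ (m + 1) := by
    have e : (monomial (b + Finsupp.single i 1) (1 : k)) = monomial b' 1 * X i ^ (m + 1) := by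
      rw [X_pow_eq_monomial, monomial_mul, one_mul, Finsupp.single_add, ← add_assoc, ← hb]
    rw [e, map_mul, map_pow, hX, if_pos rfl]
    congr 1
    rw [monomial_eq, C_1, one_mul, Finsupp.prod, map_prod]
    refine Finset.prod_congr rfl fun l hl => ?_
    rw [map_pow, hX, if_neg]
    rintro rfl
    simp [hb'] at hl
  have hc : coeff (b + Finsupp.single j 1) (act g (monomial (b + Finsupp.single i 1) (1 : k))) ≠ 0 := by
    rw [hact]
    have : b + Finsupp.single j 1 = b' + (Finsupp.single i m + Finsupp.single j 1) := by
      rw [← add_assoc, ← hb]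
    rw [this, coeff_monomial_mul, one_mul, add_pow, coeff_sum]
    have key : ∀ t ∈ Finset.range (m + 1 + 1), 
        coeff (Finsupp.single i m + Finsupp.single j 1)
          (X i ^ t * X j ^ (m + 1 - t) * ((m + 1).choose t : MvPolynomial (Fin n) k)) =
        if t = m then ((m + 1).choose t : k) else 0 := by
      intro t ht
      rw [X_pow_eq_monomial, X_pow_eq_monomial, monomial_mul, ← map_natCast C, mul_comm,
        coeff_C_mul, coeff_monomial]
      split_ifs with h1 h2 h2
      · simp
      · exfalso
        apply h2
        have := DFunLike.congr_fun h1 i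
        simpa [hji.ne] using this
      · exfalso
        apply h1
        subst h2
        simp
      · simp
    rw [Finset.sum_congr rfl key, Finset.sum_ite_eq', if_pos (by simp)]
    simp only [Nat.choose_succ_self_right]
    exact_mod_cast Nat.succ_ne_zero m
  exact (mem_mon A _).1 hmem _ (mem_support_iff.2 hc)

lemma minGen_iff (A : Set (Fin n →₀ ℕ)) (a : Fin n →₀ ℕ) :
    IsMinGen (Ideal.span ((fun a => (monomial a (1 : k))) '' A)) a ↔
      (∃ s ∈ A, s ≤ a) ∧ ∀ b l, a = b + Finsupp.single l 1 → ¬ ∃ s ∈ A, s ≤ b := by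
  unfold IsMinGen
  rw [mon_mem_mon]
  refine and_congr_right fun _ => ?_
  constructor
  · rintro h b l rfl hb
    apply h
    have : (monomial (b + Finsupp.single l 1) (1 : k)) = X l * monomial b 1 := by
      rw [X, monomial_mul, one_mul, add_comm]
    rw [this]
    exact Ideal.mul_mem_mul (Ideal.subset_span ⟨l, rfl⟩) ((mon_mem_mon A b).2 hb)
  · intro h hmem
    have hle : maxIdeal k n * Ideal.span ((fun a => (monomial a (1 : k))) '' A) ≤
        Ideal.span ((fun a => (monomial a (1 : k))) '' 
          {c | ∃ l : Fin n, ∃ s ∈ A, c = s + Finsupp.single l 1}) := by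
      rw [maxIdeal, Ideal.span_mul_span']
      apply Ideal.span_mono
      rintro _ ⟨_, ⟨l, rfl⟩, _, ⟨s, hs, rfl⟩, rfl⟩
      refine ⟨_, ⟨l, s, hs, rfl⟩, ?_⟩
      simp only [X, monomial_mul, one_mul, add_comm]
    obtain ⟨_, ⟨l, s, hs, rfl⟩, hsa⟩ := (mon_mem_mon _ _).1 (hle hmem)
    obtain ⟨d, rfl⟩ := exists_add_of_le hsa
    exact h (s + d) l (by abel) ⟨s, hs, le_self_add⟩

lemma adeg_add_single (b : Fin n →₀ ℕ) (l : Fin n) :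
    adeg (b + Finsupp.single l 1) = adeg b + 1 := by
  simp [adeg, Finset.sum_add_distrib, Finsupp.single_apply]

lemma mem_sPiece_iff (f : MvPolynomial (Fin n) k) (r : ℤ) :
    f ∈ sPiece k n r ↔ ∀ c ∈ f.support, (adeg c : ℤ) = r := by
  unfold sPiece
  split_ifs with h
  · rw [mem_homogeneousSubmodule, IsHomogeneous, IsWeightedHomogeneous]
    refine forall_congr' fun c => ?_
    rw [mem_support_iff]
    refine imp_congr_right fun _ => ?_
    have : Finsupp.weight 1 c = adeg c := by
      have h1 := DFunLike.congr_fun (Finsupp.degree_eq_weight_one (R := ℕ) (σ := Fin n)) c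
      exact h1.symm.trans (Finsupp.degree_eq_sum c)
    rw [this]
    omega
  · rw [Submodule.mem_bot]
    constructor
    · rintro rfl
      simp
    · intro hh
      rw [← support_eq_empty, Finset.eq_empty_iff_forall_notMem]
      intro c hc
      have := hh c hc
      omega

lemma mval_add_single (b : Fin n →₀ ℕ) (i : Fin n) (h : ∀ l, i < l → b l = 0) :
    mval (b + Finsupp.single i 1) = (i : ℕ) + 1 := by
  unfold mval
  apply le_antisymm
  · apply Finset.sup_le
    intro l hl
    by_contra hlt
    have hil : i < l := by
      rw [Fin.lt_def]; omega
    simp [h l hil, hil.ne] at hl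
  · apply Finset.le_sup (f := fun j : Fin n => (j : ℕ) + 1)
    simp

lemma of_mval (a : Fin n →₀ ℕ) (i : Fin n) (h : mval a = (i : ℕ) + 1) :
    0 < a i ∧ ∀ l : Fin n, (i : ℕ) + 1 ≤ l → a l = 0 := by
  constructor
  · have hne : a.support.Nonempty := by
      rw [Finset.nonempty_iff_ne_empty]
      intro he
      simp [mval, he] at h
    obtain ⟨j, hj, hji⟩ := Finset.exists_mem_eq_sup a.support hne (fun j : Fin n => (j : ℕ) + 1)
    have : j = i := by
      apply Fin.ext
      unfold mval at h
      omega
    subst this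
    exact Nat.pos_of_ne_zero (Finsupp.mem_support_iff.1 hj)
  · intro l hl
    by_contra hne
    have := Finset.le_sup (f := fun j : Fin n => (j : ℕ) + 1) (Finsupp.mem_support_iff.2 hne)
    unfold mval at h
    omega

/-- Lemma 2.3: for a Borel-fixed monomial ideal `I` in characteristic `0`, if `D` is
the maximal degree of a minimal generator `x^A` of `I` with `m(x^A) = i`, then `D - 1`
is the largest integer `r` with `[(I, xₙ, …, x_{i+1}) : xᵢ]_r ≠ (I, xₙ, …, x_{i+1})_r`. -/
theorem statement7 {k : Type*} [Field k] [CharZero k] {n : ℕ}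
    (I : Ideal (MvPolynomial (Fin n) k)) (hmon : IsMonomialIdeal I)
    (hB : IsBorelFixed I)
    (i : ℕ) (h1 : 1 ≤ i) (h2 : i ≤ n)
    (D : ℤ) (hD : IsGreatest {r : ℤ | ∃ a, IsMinGen I a ∧ mval a = i ∧ r = adeg a} D) :
    IsGreatest {r : ℤ |
      (((I ⊔ Ideal.span {f | ∃ l : Fin n, i ≤ (l : ℕ) ∧ f = X l}).colon
          (Ideal.span {(X (⟨i - 1, by omega⟩ : Fin n) : MvPolynomial (Fin n) k)}) :
          Ideal (MvPolynomial (Fin n) k)) : Set (MvPolynomial (Fin n) k)) ∩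
        (sPiece k n r : Set (MvPolynomial (Fin n) k)) ≠
      ((I ⊔ Ideal.span {f | ∃ l : Fin n, i ≤ (l : ℕ) ∧ f = X l} :
          Ideal (MvPolynomial (Fin n) k)) : Set (MvPolynomial (Fin n) k)) ∩
        (sPiece k n r : Set (MvPolynomial (Fin n) k))} (D - 1) := by
  obtain ⟨A, rfl⟩ := hmon
  set p : Fin n := ⟨i - 1, by omega⟩ with hp
  have hpi : (p : ℕ) + 1 = i := by simp [hp]; omega
  -- membership in the colon ideal
  have hcol : ∀ f : MvPolynomial (Fin n) k,
      f ∈ (Ideal.span ((fun a => (monomial a (1 : k))) '' A) ⊔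
        Ideal.span {f | ∃ l : Fin n, i ≤ (l : ℕ) ∧ f = X l}).colon
          (Ideal.span {(X p : MvPolynomial (Fin n) k)}) ↔
      ∀ c ∈ f.support, (∃ s ∈ A, s ≤ c + Finsupp.single p 1) ∨
        ∃ l : Fin n, i ≤ (l : ℕ) ∧ 0 < c l := by
    intro f
    rw [Ideal.mem_colon_span_singleton, mem_sup_mon, support_mul_X]
    simp only [Finset.mem_map, addRightEmbedding_apply, forall_exists_index, and_imp,
      forall_apply_eq_imp_iff₂]
    refine forall₂_congr fun c _ => or_congr Iff.rfl (exists_congr fun l => 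
      and_congr_right fun hl => ?_)
    have : p ≠ l := by
      intro h
      rw [← h] at hl
      omega
    simp [Finsupp.single_apply, this]
  obtain ⟨⟨a, ha, hai, rfl⟩, hmax⟩ := hD
  constructor
  · rw [minGen_iff] at ha
    obtain ⟨hpos, hz⟩ := of_mval a p (by omega)
    obtain ⟨b, rfl⟩ : ∃ b, a = b + Finsupp.single p 1 := by
      refine ⟨a - Finsupp.single p 1, (tsub_add_cancel_of_le ?_).symm⟩
      simpa [Finsupp.single_le_iff, Nat.one_le_iff_ne_zero, Nat.pos_iff_ne_zero] using hpos
    have hbz : ¬ ∃ l : Fin n, i ≤ (l : ℕ) ∧ 0 < b l := by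
      rintro ⟨l, hl, hl'⟩
      have := hz l (by omega)
      simp at this
      omega
    have hsupp : (monomial b (1 : k)).support = {b} := by
      classical
      rw [support_monomial, if_neg one_ne_zero]
    intro heq
    have hmem := (Set.ext_iff.1 heq (monomial b (1 : k))).1 ⟨by
      rw [SetLike.mem_coe, hcol, hsupp]
      intro c hc
      rw [Finset.mem_singleton] at hc
      subst hc
      exact Or.inl ha.1, by
      rw [SetLike.mem_coe, mem_sPiece_iff, hsupp]
      intro c hc
      rw [Finset.mem_singleton] at hc
      subst hc
      rw [adeg_add_single]
      push_cast
      ring⟩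
    have h3 := hmem.1
    rw [SetLike.mem_coe, mem_sup_mon, hsupp] at h3
    rcases h3 b (by simp) with h | h
    · exact ha.2 b p rfl h
    · exact hbz h
  · intro r hr
    by_contra hlt
    apply hr
    ext f
    simp only [Set.mem_inter_iff, SetLike.mem_coe]
    refine and_congr_left fun hf => ?_
    rw [hcol, mem_sup_mon]
    rw [mem_sPiece_iff] at hf
    refine forall₂_congr fun c hc => ⟨?_, ?_⟩
    · rintro (h | h)
      · by_contra hcon
        push Not at hcon
        obtain ⟨hcA, hcz⟩ := hcon
        have hcA' : ¬ ∃ s ∈ A, s ≤ c := fun ⟨s, hs, hsc⟩ => hcA s hs hsc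
        have hz : ∀ l, p < l → c l = 0 := by
          intro l hl
          rw [Fin.lt_def] at hl
          have := hcz l (by omega)
          omega
        have hgen : IsMinGen (Ideal.span ((fun a => (monomial a (1 : k))) '' A))
            (c + Finsupp.single p 1) := by
          rw [minGen_iff]
          refine ⟨h, ?_⟩
          intro b l hbl hb
          apply hcA'
          by_cases hlp : l = p
          · subst hlp
            rwa [add_right_cancel hbl]
          · have hcl : 0 < c l := by
              have := DFunLike.congr_fun hbl l
              simp [Finsupp.single_apply, Ne.symm hlp] at this
              omega
            have hltp : l < p := by
              rcases lt_trichotomy l p with h | h | h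
              · exact h
              · exact absurd h hlp
              · have := hz l h
                omega
            obtain ⟨d, rfl⟩ : ∃ d, c = d + Finsupp.single l 1 := by
              refine ⟨c - Finsupp.single l 1, (tsub_add_cancel_of_le ?_).symm⟩
              simpa [Finsupp.single_le_iff, Nat.one_le_iff_ne_zero, Nat.pos_iff_ne_zero] using hcl
            have hbd : b = d + Finsupp.single p 1 := by
              apply add_right_cancel (b := Finsupp.single l 1)
              rw [← hbl]
              abel
            rw [hbd] at hb
            exact borel_step A hB d l p hltp hb
        have := hmax ⟨_, hgen, by rw [mval_add_single c p hz, hpi], rfl⟩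
        rw [adeg_add_single] at this
        have h5 := hf c hc
        push_cast at this
        omega
      · exact Or.inr h
    · rintro (⟨s, hs, hsc⟩ | h)
      · exact Or.inl ⟨s, hs, hsc.trans le_self_add⟩
      · exact Or.inr h
end
end Paper
end
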